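/- Let β > 0 with 2π²β² ≠ 1, and let Ω_β be the class of admissible functions R with R(x) ≥ 0 for all real x and R(β) ≥ 1, R(−β) ≥ 1. Then Δ(β) := inf_{R∈Ω_β} M(R) = 2/(K(β,β) + |K(β,−β)|), and the infimum is attained by some R ∈ Ω_β. -/

import Mathlib

open Filter MeasureTheory Real Complex

/-- The constant `2^{-1/2}`. -/
noncomputable def invSqrt2 : ℝ := (Real.sqrt 2)⁻¹

/-- The entire extension of `sin z / z`. -/
noncomputable def csinc (z : ℂ) : ℂ := if z = 0 then 1 else Complex.sin z / z

/-- The coefficient `c(w)`. -/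
noncomputable def cCoef (w : ℂ) : ℂ :=
  (Complex.cos ((π : ℂ) * w) - (π : ℂ) * w * Complex.sin ((π : ℂ) * w)) /
    ((1 - 2 * (π : ℂ) ^ 2 * w ^ 2) *
      ((Real.cos invSqrt2 : ℂ) - (invSqrt2 : ℂ) * (Real.sin invSqrt2 : ℂ)))

/-- The coefficient `d(w)`. -/
noncomputable def dCoef (w : ℂ) : ℂ :=
  (2 * (π : ℂ) * w * Complex.cos ((π : ℂ) * w)) /
    ((1 - 2 * (π : ℂ) ^ 2 * w ^ 2) * (Real.sqrt 2 : ℂ) * (Real.cos invSqrt2 : ℂ))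

/-- `f(w,z) = (2π²w²/(2π²w²−1)) · sin π(z−w)/(π(z−w))` (with the removable singularity at
`z = w` filled in). -/
noncomputable def fFun (w z : ℂ) : ℂ :=
  (2 * (π : ℂ) ^ 2 * w ^ 2 / (2 * (π : ℂ) ^ 2 * w ^ 2 - 1)) * csinc ((π : ℂ) * (z - w))

/-- The value of `g` at the removable singularities `±1/(π√2)`. -/
noncomputable def gSingVal : ℂ := 1 / 2 + (Real.sin (Real.sqrt 2) / (2 * Real.sqrt 2) : ℝ)

/-- The value of `h` at the removable singularity `1/(π√2)`. -/
noncomputable def hSingVal : ℂ := 1 / 2 - (Real.sin (Real.sqrt 2) / (2 * Real.sqrt 2) : ℝ)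

/-- `g(z) = (√2 sin(2^{-1/2}) cos πz − 2πz cos(2^{-1/2}) sin πz)/(1 − 2π²z²)`, with the
removable singularities at `±1/(π√2)` filled in by continuity. -/
noncomputable def gFun (z : ℂ) : ℂ :=
  if 1 - 2 * (π : ℂ) ^ 2 * z ^ 2 = 0 then gSingVal
  else ((Real.sqrt 2 * Real.sin invSqrt2 : ℝ) * Complex.cos ((π : ℂ) * z)
      - 2 * (π : ℂ) * z * (Real.cos invSqrt2 : ℂ) * Complex.sin ((π : ℂ) * z)) /
    (1 - 2 * (π : ℂ) ^ 2 * z ^ 2)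

/-- `h(z) = (2πz sin(2^{-1/2}) cos πz − √2 cos(2^{-1/2}) sin πz)/(1 − 2π²z²)`, with the
removable singularities at `±1/(π√2)` filled in by continuity. -/
noncomputable def hFun (z : ℂ) : ℂ :=
  if z = ((π * Real.sqrt 2)⁻¹ : ℝ) then hSingVal
  else if z = -((π * Real.sqrt 2)⁻¹ : ℝ) then -hSingVal
  else (2 * (π : ℂ) * z * (Real.sin invSqrt2 : ℂ) * Complex.cos ((π : ℂ) * z)
      - (Real.sqrt 2 * Real.cos invSqrt2 : ℝ) * Complex.sin ((π : ℂ) * z)) /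
    (1 - 2 * (π : ℂ) ^ 2 * z ^ 2)

/-- The reproducing kernel `K(w,z) = f(w̄,z) + c(w̄) g(z) + d(w̄) h(z)` for the pair
correlation measure. -/
noncomputable def Kker (w z : ℂ) : ℂ :=
  fFun ((starRingEnd ℂ) w) z + cCoef ((starRingEnd ℂ) w) * gFun z
    + dCoef ((starRingEnd ℂ) w) * hFun z

/-- The pair correlation density `1 - (sin πx / (πx))²`. -/
noncomputable def pairCorKernel (x : ℝ) : ℝ := 1 - (Real.sin (π * x) / (π * x)) ^ 2

/-- The pair correlation measure `dμ(x) = {1 - (sin πx/(πx))²} dx`. -/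
noncomputable def pairCorMeasure : Measure ℝ :=
  volume.withDensity fun x => ENNReal.ofReal (pairCorKernel x)

/-- An entire function has exponential type at most `τ`. -/
def HasExpTypeLE (F : ℂ → ℂ) (τ : ℝ) : Prop :=
  ∀ ε > 0, ∃ C > 0, ∀ z : ℂ, ‖F z‖ ≤ C * Real.exp ((τ + ε) * ‖z‖)

/-- A function `R : ℝ → ℝ` is admissible if it is integrable and extends to an entire
function of exponential type at most `2π`. -/
def IsAdmissible (R : ℝ → ℝ) : Prop :=
  Integrable R ∧
    ∃ F : ℂ → ℂ, Differentiable ℂ F ∧ HasExpTypeLE F (2 * π) ∧ ∀ x : ℝ, F x = (R x : ℂ)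

/-- `M(R) = ∫ R(x) {1 - (sin πx/(πx))²} dx`. -/
noncomputable def Mpc (R : ℝ → ℝ) : ℝ := ∫ x : ℝ, R x * pairCorKernel x

/-- The class `Ω_β` of nonnegative admissible functions with `R(±β) ≥ 1`. -/
def OmegaClass (β : ℝ) : Set (ℝ → ℝ) :=
  {R | IsAdmissible R ∧ (∀ x : ℝ, 0 ≤ R x) ∧ 1 ≤ R β ∧ 1 ≤ R (-β)}

section

open Polynomial in
lemma fr_infinite_circle : {z : ℂ | ‖z‖ = 1}.Infinite := by
  have h : Function.Injective (fun n : ℕ => Complex.exp (((1:ℝ) / (n + 1) : ℝ) * Complex.I)) := by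
    intro a b hab
    have := Complex.exp_inj_of_neg_pi_lt_of_le_pi (x := (((1:ℝ) / (a + 1) : ℝ) * Complex.I)) (y := (((1:ℝ) / (b + 1) : ℝ) * Complex.I)) ?_ ?_ ?_ ?_ hab
    · have h2 : ((1:ℝ) / (a + 1)) = (1:ℝ) / (b + 1) := by
        have := congrArg Complex.im this
        simp only [Complex.mul_I_im, Complex.ofReal_re] at this
        exact this
      have ha : (0:ℝ) < a + 1 := by positivity
      have hb : (0:ℝ) < b + 1 := by positivity
      field_simp at h2
      have : (a:ℝ) = b := by linarith
      exact_mod_cast this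
    all_goals
      simp only [Complex.mul_I_im, Complex.ofReal_re]
    · have : (0:ℝ) < 1 / (a + 1) := by positivity
      linarith [Real.pi_pos]
    · have : (1:ℝ) / (a + 1) ≤ 1 := by
        rw [div_le_one (by positivity)]; linarith [(Nat.cast_nonneg a : (0:ℝ) ≤ a)]
      linarith [Real.pi_gt_three]
    · have : (0:ℝ) < 1 / (b + 1) := by positivity
      linarith [Real.pi_pos]
    · have : (1:ℝ) / (b + 1) ≤ 1 := by
        rw [div_le_one (by positivity)]; linarith [(Nat.cast_nonneg b : (0:ℝ) ≤ b)]
      linarith [Real.pi_gt_three]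
  refine (Set.infinite_range_of_injective h).mono ?_
  rintro _ ⟨n, rfl⟩
  simp only [Set.mem_ofPred_eq]
  exact Complex.norm_exp_ofReal_mul_I _

open Polynomial in
lemma fr_eval_reflect (q : ℂ[X]) (N : ℕ) (hq : q.natDegree ≤ N) (z : ℂ) (hz : z ≠ 0) :
    (reflect N (q.map (starRingEnd ℂ))).eval z = z ^ N * (starRingEnd ℂ) (q.eval ((starRingEnd ℂ) z⁻¹)) := by
  have hi : z⁻¹ ≠ 0 := inv_ne_zero hz
  let _ : Invertible z⁻¹ := invertibleOfNonzero hi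
  have h := eval₂_reflect_mul_pow (RingHom.id ℂ) z⁻¹ N (q.map (starRingEnd ℂ))
    (le_trans natDegree_map_le hq)
  rw [invOf_eq_inv, inv_inv] at h
  have e1 : (starRingEnd ℂ) (q.eval ((starRingEnd ℂ) z⁻¹)) = (q.map (starRingEnd ℂ)).eval z⁻¹ := by
    rw [← eval₂_at_apply, Complex.conj_conj, eval₂_eq_eval_map]
  change eval z _ * _ = eval z⁻¹ _ at h
  rw [e1, ← h, inv_pow]
  have : z ^ N ≠ 0 := pow_ne_zero _ hz
  field_simp

open Polynomial in
lemma fr_selfrec (q : ℂ[X]) (M : ℕ) (hq : q.natDegree ≤ 2 * M)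
    (h : ∀ z : ℂ, ‖z‖ = 1 → ∃ r : ℝ, 0 < r ∧ q.eval z = r * z ^ M) :
    reflect (2 * M) (q.map (starRingEnd ℂ)) = q := by
  apply eq_of_infinite_eval_eq
  refine fr_infinite_circle.mono ?_
  intro z hz
  simp only [Set.mem_ofPred_eq] at hz ⊢
  have hz0 : z ≠ 0 := by
    rintro rfl; simp at hz
  rw [fr_eval_reflect q _ hq z hz0]
  have hc : (starRingEnd ℂ) z⁻¹ = z := by
    rw [Complex.inv_def, Complex.normSq_eq_norm_sq, hz]; simp
  obtain ⟨r, hr, he⟩ := h z hz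
  have hzz : (starRingEnd ℂ) z = z⁻¹ := by
    have := congrArg (starRingEnd ℂ) hc
    rw [Complex.conj_conj] at this
    exact this.symm
  rw [hc, he, map_mul, map_pow, Complex.conj_ofReal, hzz, two_mul, pow_add, inv_pow]
  have : z ^ M ≠ 0 := pow_ne_zero _ hz0
  field_simp

open Polynomial in
/-- Fejér–Riesz for strictly positive trigonometric polynomials. -/
lemma fejer_riesz (m : ℕ) : ∀ q : ℂ[X], q.natDegree ≤ 2 * m →
    (∀ z : ℂ, ‖z‖ = 1 → ∃ r : ℝ, 0 < r ∧ q.eval z = r * z ^ m) →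
    ∃ p : ℂ[X], p.natDegree ≤ m ∧ ∀ z : ℂ, ‖z‖ = 1 →
      q.eval z = ((‖p.eval z‖ ^ 2 : ℝ) : ℂ) * z ^ m := by
  induction m with
  | zero =>
    intro q hq h
    have hq0 : q = C (q.coeff 0) := eq_C_of_natDegree_le_zero (by simpa using hq)
    obtain ⟨r, hr, he⟩ := h 1 (by simp)
    refine ⟨C ((Real.sqrt r : ℝ) : ℂ), by simp, ?_⟩
    intro z hz
    rw [hq0] at he ⊢
    simp only [eval_C, pow_zero, mul_one] at he ⊢
    rw [he, Complex.norm_real, Real.norm_eq_abs, sq_abs, Real.sq_sqrt hr.le]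
  | succ m ih =>
    intro q hq h
    have hs := fr_selfrec q (m + 1) hq h
    have hne : ∀ z : ℂ, ‖z‖ = 1 → z ≠ 0 := by
      rintro z hz rfl; simp at hz
    by_cases h0 : q.coeff 0 = 0
    · have hX : X ∣ q := X_dvd_iff.mpr h0
      obtain ⟨q1, rfl⟩ := hX
      have htop : (X * q1).coeff (2 * (m + 1)) = 0 := by
        rw [← hs]; simp [coeff_reflect]
      have hd : q1.natDegree ≤ 2 * m := by
        rw [natDegree_le_iff_coeff_eq_zero]
        intro N hN
        have : (X * q1).coeff (N + 1) = 0 := by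
          rcases eq_or_ne (N + 1) (2 * (m + 1)) with e | e
          · rw [e]; exact htop
          · exact coeff_eq_zero_of_natDegree_lt (by omega)
        simpa using this
      have h1 : ∀ z : ℂ, ‖z‖ = 1 → ∃ r : ℝ, 0 < r ∧ q1.eval z = r * z ^ m := by
        intro z hz
        obtain ⟨r, hr, he⟩ := h z hz
        refine ⟨r, hr, ?_⟩
        rw [eval_mul, eval_X, pow_succ] at he
        apply mul_left_cancel₀ (hne z hz)
        rw [he]; ring
      obtain ⟨p, hp, hpe⟩ := ih q1 hd h1
      refine ⟨p, by omega, ?_⟩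
      intro z hz
      rw [eval_mul, eval_X, hpe z hz]; ring
    · have htop : q.coeff (2 * (m + 1)) ≠ 0 := by
        rw [← hs]; simpa [coeff_reflect] using h0
      have hdeg : 0 < q.degree := by
        rw [← natDegree_pos_iff_degree_pos]
        have := le_natDegree_of_ne_zero htop
        omega
      obtain ⟨ρ, hρ⟩ := Complex.exists_root hdeg
      have hρ0 : ρ ≠ 0 := by
        rintro rfl
        apply h0
        rw [coeff_zero_eq_eval_zero]; exact hρ
      have hρ1 : ‖ρ‖ ≠ 1 := by
        intro h1
        obtain ⟨r, hr, he⟩ := h ρ h1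
        rw [hρ.eq_zero] at he
        have : (r:ℂ) ≠ 0 := by exact_mod_cast hr.ne'
        exact mul_ne_zero this (pow_ne_zero _ hρ0) he.symm
      set τ : ℂ := (starRingEnd ℂ) ρ⁻¹ with hτ
      have hτ0 : τ ≠ 0 := by simp [hτ, hρ0]
      have hτr : q.IsRoot τ := by
        rw [IsRoot, ← hs, fr_eval_reflect q _ hq τ hτ0]
        have : (starRingEnd ℂ) τ⁻¹ = ρ := by simp [hτ]
        rw [this, hρ.eq_zero]; simp
      have hτρ : τ ≠ ρ := by
        intro e
        have : ‖τ‖ = ‖ρ‖⁻¹ := by simp [hτ]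
        rw [e] at this
        have hp : 0 < ‖ρ‖ := by positivity
        apply hρ1
        field_simp at this
        nlinarith
      obtain ⟨q0, hq0⟩ := dvd_iff_isRoot.mpr hρ
      have hτ' : q0.IsRoot τ := by
        have := hτr
        rw [IsRoot, hq0, eval_mul] at this
        rcases mul_eq_zero.mp this with e | e
        · simp at e; exact absurd (sub_eq_zero.mp e) hτρ
        · exact e
      obtain ⟨q1, hq1⟩ := dvd_iff_isRoot.mpr hτ'
      have hqne : q ≠ 0 := by rintro rfl; simp at h0
      have hq1ne : q1 ≠ 0 := by
        rintro rfl
        simp at hq1; rw [hq1] at hq0; simp at hq0; exact hqne hq0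
      have hd1 : q1.natDegree ≤ 2 * m := by
        have e : q = ((X - C ρ) * (X - C τ)) * q1 := by rw [hq0, hq1]; ring
        have : q.natDegree = 2 + q1.natDegree := by
          rw [e, natDegree_mul (mul_ne_zero (X_sub_C_ne_zero _) (X_sub_C_ne_zero _)) hq1ne,
            natDegree_mul (X_sub_C_ne_zero _) (X_sub_C_ne_zero _), natDegree_X_sub_C, natDegree_X_sub_C]
        omega
      have key : ∀ z : ℂ, ‖z‖ = 1 → q.eval z = ((‖z - ρ‖ ^ 2 : ℝ) : ℂ) * z * ((C (-τ) * q1).eval z) := by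
        intro z hz
        rw [hq0, hq1]
        simp only [eval_mul, eval_sub, eval_X, eval_C]
        have hzz : z * (starRingEnd ℂ) z = 1 := by
          rw [Complex.mul_conj, Complex.normSq_eq_norm_sq, hz]; simp
        have hn : ((‖z - ρ‖ ^ 2 : ℝ) : ℂ) = (z - ρ) * ((starRingEnd ℂ) z - (starRingEnd ℂ) ρ) := by
          rw [← Complex.normSq_eq_norm_sq, ← Complex.mul_conj, map_sub]
        have hρτ : (starRingEnd ℂ) ρ * τ = 1 := by
          rw [hτ, ← map_mul, mul_inv_cancel₀ hρ0, map_one]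
        rw [hn]
        have : (z - τ) = ((starRingEnd ℂ) z - (starRingEnd ℂ) ρ) * z * (-τ) := by
          linear_combination τ * hzz - z * hρτ
        rw [this]; ring
      have h1 : ∀ z : ℂ, ‖z‖ = 1 → ∃ r : ℝ, 0 < r ∧ (C (-τ) * q1).eval z = r * z ^ m := by
        intro z hz
        obtain ⟨r, hr, he⟩ := h z hz
        have hzρ : 0 < ‖z - ρ‖ := by
          rw [norm_pos_iff, sub_ne_zero]; rintro rfl; exact hρ1 hz
        refine ⟨r / ‖z - ρ‖ ^ 2, by positivity, ?_⟩
        rw [key z hz] at he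
        have hc : ((‖z - ρ‖ ^ 2 : ℝ) : ℂ) ≠ 0 := by
          exact_mod_cast (by positivity : ‖z - ρ‖ ^ 2 ≠ 0)
        have hz0 := hne z hz
        rw [Complex.ofReal_div]
        field_simp
        apply mul_left_cancel₀ hz0
        rw [pow_succ z] at he
        linear_combination he
      obtain ⟨p, hp, hpe⟩ := ih (C (-τ) * q1) (le_trans (natDegree_C_mul_le _ _) hd1) h1
      refine ⟨(X - C ρ) * p, ?_, ?_⟩
      · refine le_trans natDegree_mul_le ?_
        rw [natDegree_X_sub_C]; omega
      · intro z hz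
        rw [key z hz, hpe z hz]
        simp only [eval_mul, eval_sub, eval_X, eval_C, norm_mul]
        push_cast
        ring

end

section

lemma pl_upper (S : ℂ → ℂ) (hS : Differentiable ℂ S) (A C M : ℝ) (hA : 0 ≤ A)
    (hb : ∀ z, ‖S z‖ ≤ C * Real.exp (A * ‖z‖)) (hM : ∀ x : ℝ, ‖S x‖ ≤ M) (z : ℂ) (hz : 0 ≤ z.im) :
    ‖S z‖ ≤ M * Real.exp (A * z.im) := by
  have hC : 0 ≤ C := by
    have := (norm_nonneg _).trans (hb 0)
    simpa using this
  set f : ℂ → ℂ := fun ζ => S (I * ζ) * Complex.exp (-A * ζ) with hf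
  have hfd : Differentiable ℂ f := by
    have : Differentiable ℂ (fun ζ => S (I * ζ)) := hS.comp (by fun_prop)
    exact this.mul (by fun_prop)
  have hfn : ∀ ζ, ‖f ζ‖ = ‖S (I * ζ)‖ * Real.exp (-A * ζ.re) := by
    intro ζ
    rw [hf]; simp only [norm_mul, Complex.norm_exp]
    congr 2
    simp
  have key : ‖f (-I * z)‖ ≤ M := by
    apply PhragmenLindelof.right_half_plane_of_bounded_on_real (f := f) hfd.diffContOnCl
    · refine ⟨1, by norm_num, 2 * A, ?_⟩
      apply Asymptotics.IsBigO.of_bound C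
      refine Filter.Eventually.of_forall ?_
      intro ζ
      rw [hfn, Real.rpow_one, Real.norm_eq_abs, abs_of_pos (Real.exp_pos _)]
      have h1 := hb (I * ζ)
      rw [norm_mul, norm_I, one_mul] at h1
      have h2 : Real.exp (-A * ζ.re) ≤ Real.exp (A * ‖ζ‖) := by
        apply Real.exp_le_exp.mpr
        have := Complex.abs_re_le_norm ζ
        have := neg_abs_le ζ.re
        nlinarith
      calc _ ≤ (C * Real.exp (A * ‖ζ‖)) * Real.exp (A * ‖ζ‖) := by
            apply mul_le_mul h1 h2 (Real.exp_pos _).le (by positivity)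
        _ = _ := by rw [mul_assoc, ← Real.exp_add]; ring_nf
    · refine ⟨C, ?_⟩
      simp only [eventually_map]
      filter_upwards [eventually_ge_atTop 0] with x hx
      rw [hfn]
      have h1 := hb (I * x)
      rw [norm_mul, norm_I, one_mul, Complex.norm_real, Real.norm_eq_abs, abs_of_nonneg hx] at h1
      calc _ ≤ (C * Real.exp (A * x)) * Real.exp (-A * x) := by
            apply mul_le_mul h1 (by simp) (Real.exp_pos _).le (by positivity)
        _ = C := by rw [mul_assoc, ← Real.exp_add]; simp
    · intro x
      rw [hfn]
      have : I * (x * I) = ((-x : ℝ) : ℂ) := by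
        push_cast; linear_combination x * I_mul_I
      rw [this]
      simpa using hM (-x)
    · simpa using hz
  rw [hfn] at key
  have e : I * (-I * z) = z := by linear_combination -z * I_mul_I
  rw [e] at key
  have e2 : (-I * z).re = z.im := by simp
  rw [e2] at key
  calc ‖S z‖ = ‖S z‖ * Real.exp (-A * z.im) * Real.exp (A * z.im) := by
        rw [mul_assoc, ← Real.exp_add]; simp
    _ ≤ _ := by gcongr

lemma pl_both (S : ℂ → ℂ) (hS : Differentiable ℂ S) (A C M : ℝ) (hA : 0 ≤ A)
    (hb : ∀ z, ‖S z‖ ≤ C * Real.exp (A * ‖z‖)) (hM : ∀ x : ℝ, ‖S x‖ ≤ M) (z : ℂ) :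
    ‖S z‖ ≤ M * Real.exp (A * |z.im|) := by
  rcases le_total 0 z.im with h | h
  · rw [abs_of_nonneg h]; exact pl_upper S hS A C M hA hb hM z h
  · rw [abs_of_nonpos h]
    have := pl_upper (fun w => S (-w)) (hS.comp (by fun_prop)) A C M hA
      (fun z => by simpa using hb (-z)) (fun x => by simpa using hM (-x)) (-z) (by simpa using h)
    simpa using this

lemma entire_primitive (F : ℂ → ℂ) (hF : Differentiable ℂ F) (z : ℂ) :
    HasDerivAt (fun w => wedgeIntegral 0 w F) (F z) z := by
  have hc : IsConservativeOn F (Metric.ball 0 (‖z‖ + 1)) :=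
    hF.differentiableOn.isConservativeOn
  exact hc.hasDerivAt_wedgeIntegral hF.continuous.continuousOn (by simp)

lemma bound_of_expType (R : ℝ → ℝ) (hR : Integrable R) (F : ℂ → ℂ) (hF : Differentiable ℂ F)
    (τ : ℝ) (hτ : 0 ≤ τ)
    (hexp : ∀ ε > 0, ∃ C > 0, ∀ z : ℂ, ‖F z‖ ≤ C * Real.exp ((τ + ε) * ‖z‖))
    (hFR : ∀ x : ℝ, F x = (R x : ℂ)) (ε : ℝ) (hε : 0 < ε) :
    ∃ C > 0, ∀ z : ℂ, ‖F z‖ ≤ C * Real.exp ((τ + ε) * |z.im|) := by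
  obtain ⟨C, hC, hb⟩ := hexp (ε / 2) (by positivity)
  set S : ℂ → ℂ := fun w => wedgeIntegral 0 w F with hSdef
  have hSd : ∀ z, HasDerivAt S (F z) z := entire_primitive F hF
  have hSdiff : Differentiable ℂ S := fun z => (hSd z).differentiableAt
  have hSb : ∀ z, ‖S z‖ ≤ (4 * C / ε) * Real.exp ((τ + ε) * ‖z‖) := by
    intro z
    have hpt : ∀ w : ℂ, ‖w‖ ≤ ‖z‖ → ‖F w‖ ≤ C * Real.exp ((τ + ε / 2) * ‖z‖) := by
      intro w hw
      refine (hb w).trans ?_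
      gcongr
    have h1 : ‖∫ x : ℝ in (0:ℂ).re..z.re, F (x + (0:ℂ).im * I)‖ ≤
        C * Real.exp ((τ + ε / 2) * ‖z‖) * |z.re - (0:ℂ).re| := by
      apply intervalIntegral.norm_integral_le_of_norm_le_const
      intro x hx
      apply hpt
      simp only [zero_im, ofReal_zero, zero_mul, add_zero, Complex.norm_real, Real.norm_eq_abs]
      refine le_trans ?_ (Complex.abs_re_le_norm z)
      rcases Set.mem_uIoc.mp hx with ⟨h1, h2⟩ | ⟨h1, h2⟩
      · simp at h1; rw [abs_of_pos h1, abs_of_nonneg (h1.le.trans h2)]; exact h2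
      · simp at h2; rw [abs_of_nonpos h2, abs_of_nonpos (h1.le.trans h2)]; linarith
    have h2 : ‖∫ y : ℝ in (0:ℂ).im..z.im, F (z.re + y * I)‖ ≤
        C * Real.exp ((τ + ε / 2) * ‖z‖) * |z.im - (0:ℂ).im| := by
      apply intervalIntegral.norm_integral_le_of_norm_le_const
      intro y hy
      apply hpt
      have : |y| ≤ |z.im| := by
        rcases Set.mem_uIoc.mp hy with ⟨h1, h2⟩ | ⟨h1, h2⟩
        · simp at h1; rw [abs_of_pos h1, abs_of_nonneg (h1.le.trans h2)]; exact h2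
        · simp at h2; rw [abs_of_nonpos h2, abs_of_nonpos (h1.le.trans h2)]; linarith
      rw [Complex.norm_add_mul_I, Complex.norm_eq_sqrt_sq_add_sq]
      apply Real.sqrt_le_sqrt
      have := sq_le_sq.mpr this
      linarith
    have h3 : ‖S z‖ ≤ C * Real.exp ((τ + ε / 2) * ‖z‖) * (2 * ‖z‖) := by
      rw [hSdef]
      simp only [wedgeIntegral]
      refine (norm_add_le _ _).trans ?_
      rw [norm_smul, norm_I, one_mul]
      refine (add_le_add h1 h2).trans ?_
      rw [← mul_add]
      have := Complex.abs_re_le_norm z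
      have := Complex.abs_im_le_norm z
      gcongr
      simp; linarith
    refine h3.trans ?_
    have h4 : ‖z‖ ≤ (2 / ε) * Real.exp (ε / 2 * ‖z‖) := by
      have := Real.add_one_le_exp (ε / 2 * ‖z‖)
      rw [div_mul_eq_mul_div, le_div_iff₀ hε]
      nlinarith
    calc _ ≤ C * Real.exp ((τ + ε / 2) * ‖z‖) * (2 * ((2 / ε) * Real.exp (ε / 2 * ‖z‖))) := by gcongr
      _ = (4 * C / ε) * (Real.exp ((τ + ε / 2) * ‖z‖) * Real.exp (ε / 2 * ‖z‖)) := by ring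
      _ = _ := by rw [← Real.exp_add]; ring_nf
  have hSM : ∀ x : ℝ, ‖S x‖ ≤ ∫ x, ‖R x‖ := by
    intro x
    rw [hSdef]
    simp only [wedgeIntegral, zero_re, ofReal_re, zero_im, ofReal_zero, zero_mul, add_zero, ofReal_im,
      intervalIntegral.integral_same, smul_zero]
    simp only [hFR]
    refine intervalIntegral.norm_integral_le_integral_norm_uIoc.trans ?_
    simp only [Complex.norm_real]
    apply setIntegral_le_integral hR.norm
    exact Eventually.of_forall (fun x => norm_nonneg _)
  have hSfin := pl_both S hSdiff (τ + ε) _ _ (by positivity) hSb hSM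
  set M := ∫ x, ‖R x‖
  have hM0 : 0 ≤ M := integral_nonneg (fun _ => norm_nonneg _)
  refine ⟨(M + 1) * Real.exp (τ + ε), by positivity, ?_⟩
  intro z
  have hder : deriv S z = F z := (hSd z).deriv
  rw [← hder]
  have := Complex.norm_deriv_le_of_forall_mem_sphere_norm_le (c := z) (R := 1)
    (C := M * Real.exp ((τ + ε) * (|z.im| + 1))) one_pos (f := S) hSdiff.diffContOnCl ?_
  · rw [div_one] at this
    refine this.trans ?_
    rw [mul_assoc, ← Real.exp_add]
    have e : (τ + ε) + (τ + ε) * |z.im| = (τ + ε) * (|z.im| + 1) := by ring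
    rw [e]
    gcongr
    linarith
  · intro w hw
    refine (hSfin w).trans ?_
    gcongr
    have h1 : |(w - z).im| ≤ 1 := by
      refine (Complex.abs_im_le_norm _).trans ?_
      rw [mem_sphere_iff_norm] at hw; exact hw.le
    rw [sub_im] at h1
    have := abs_sub_abs_le_abs_sub w.im z.im
    linarith

end

section

lemma contour_shift (G : ℂ → ℂ) (hG : Differentiable ℂ G) (Y D : ℝ)
    (hb : ∀ z : ℂ, |z.im| ≤ |Y| → ‖G z‖ ≤ D / (1 + z.re ^ 2)) :
    ∫ x : ℝ, G x = ∫ x : ℝ, G (x + Y * I) := by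
  have hintg : ∀ y : ℝ, |y| ≤ |Y| → Integrable (fun x : ℝ => G (x + y * I)) := by
    intro y hy
    refine Integrable.mono' ((integrable_inv_one_add_sq).const_mul D)
      (Continuous.aestronglyMeasurable (hG.continuous.comp (by fun_prop))) ?_
    refine Eventually.of_forall fun x => ?_
    have := hb (x + y * I) (by simpa using hy)
    simpa [div_eq_mul_inv] using this
  have h0 : Integrable (fun x : ℝ => G x) := by simpa using hintg 0 (by simp)
  have hY := hintg Y le_rfl
  have t1 := intervalIntegral_tendsto_integral h0 tendsto_neg_atTop_atBot tendsto_id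
  have t2 := intervalIntegral_tendsto_integral hY tendsto_neg_atTop_atBot tendsto_id
  have hv : ∀ s : ℝ → ℝ, (∀ T, s T ^ 2 = T ^ 2) →
      Tendsto (fun T : ℝ => ∫ y : ℝ in (0:ℝ)..Y, G (s T + y * I)) atTop (nhds 0) := by
    intro s hs
    have hbd : ∀ T : ℝ, ‖∫ y : ℝ in (0:ℝ)..Y, G (s T + y * I)‖ ≤ D / (1 + T ^ 2) * |Y - 0| := by
      intro T
      apply intervalIntegral.norm_integral_le_of_norm_le_const
      intro y hy
      have h1 : |y| ≤ |Y| := by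
        rcases Set.mem_uIoc.mp hy with ⟨h1, h2⟩ | ⟨h1, h2⟩
        · rw [abs_of_pos h1, abs_of_nonneg (h1.le.trans h2)]; exact h2
        · rw [abs_of_nonpos h2, abs_of_nonpos (h1.le.trans h2)]; linarith
      have := hb (s T + y * I) (by simpa using h1)
      simpa [hs T] using this
    apply squeeze_zero_norm hbd
    have : Tendsto (fun T : ℝ => D / (1 + T ^ 2)) atTop (nhds 0) := by
      apply Tendsto.div_atTop tendsto_const_nhds
      exact tendsto_atTop_add_const_left _ _ (tendsto_pow_atTop (by norm_num))
    simpa using this.mul_const |Y - 0|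
  have hr : ∀ T : ℝ, (∫ x : ℝ in (-T)..T, G x) = (∫ x : ℝ in (-T)..T, G (x + Y * I))
      - I * (∫ y : ℝ in (0:ℝ)..Y, G ((T : ℝ) + y * I)) + I * ∫ y : ℝ in (0:ℝ)..Y, G ((-T : ℝ) + y * I) := by
    intro T
    have := Complex.integral_boundary_rect_eq_zero_of_differentiableOn G (-T : ℝ) (T + Y * I)
      hG.differentiableOn
    simp only [ofReal_re, ofReal_im, add_re, mul_re, I_re, I_im, mul_zero, mul_one, sub_zero, add_zero,
      add_im, mul_im, ofReal_zero, zero_mul, zero_add, smul_eq_mul] at this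
    linear_combination this
  have t3 := (t2.sub ((hv (fun T => T) (fun T => rfl)).const_mul I)).add
    ((hv (fun T => -T) (fun T => by simp)).const_mul I)
  have t4 : Tendsto (fun T : ℝ => ∫ x : ℝ in (-T)..T, G x) atTop (nhds (∫ x : ℝ, G (x + Y * I))) := by
    simp only [mul_zero, sub_zero, add_zero] at t3
    refine t3.congr ?_
    intro T
    exact (hr T).symm
  exact tendsto_nhds_unique t1 t4

open FourierTransform in
lemma fourier_vanish (H : ℂ → ℂ) (hH : Differentiable ℂ H) (a C : ℝ) (ha : 0 ≤ a)
    (hb : ∀ z : ℂ, ‖H z‖ ≤ C * Real.exp (a * |z.im|) / (1 + z.re ^ 2)) (t : ℝ)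
    (ht : a < 2 * π * |t|) : 𝓕 (fun x : ℝ => H x) t = 0 := by
  have hC : 0 ≤ C := by
    have := (norm_nonneg _).trans (hb 0)
    simpa using this
  set G : ℂ → ℂ := fun z => Complex.exp (-2 * π * t * z * I) * H z with hGdef
  have hG : Differentiable ℂ G := by
    have : Differentiable ℂ (fun z : ℂ => Complex.exp (-2 * π * t * z * I)) := by fun_prop
    exact this.mul hH
  have e1 : 𝓕 (fun x : ℝ => H x) t = ∫ x : ℝ, G x := by
    rw [Real.fourier_eq']
    congr 1; ext x
    simp only [hGdef, smul_eq_mul, RCLike.inner_apply, conj_trivial]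
    congr 2
    push_cast
    ring
  rw [e1]
  have hGn : ∀ z : ℂ, ‖G z‖ = Real.exp (2 * π * t * z.im) * ‖H z‖ := by
    intro z
    simp only [hGdef, norm_mul, Complex.norm_exp]
    congr 2
    simp
  have hmain : ∀ n : ℕ, ‖∫ x : ℝ, G x‖ ≤ (C * π) * Real.exp (-(2 * π * |t| - a) * n) := by
    intro n
    obtain ⟨Y, hYn, hYt⟩ : ∃ Y : ℝ, |Y| = n ∧ t * Y = -|t| * n := by
      rcases le_total 0 t with h | h
      · exact ⟨-n, by simp, by rw [abs_of_nonneg h]; ring⟩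
      · exact ⟨n, by simp, by rw [abs_of_nonpos h]; ring⟩
    rw [contour_shift G hG Y (C * Real.exp (a * |Y|) * Real.exp (2 * π * |t| * |Y|))]
    · have : ∀ x : ℝ, ‖G (x + Y * I)‖ ≤ (C * Real.exp (-(2 * π * |t| - a) * n)) * (1 + x ^ 2)⁻¹ := by
        intro x
        rw [hGn]
        have h := hb (x + Y * I)
        simp at h
        simp only [add_im, ofReal_im, mul_im, I_im, I_re, mul_one, mul_zero, add_zero, zero_add, ofReal_re]
        calc _ ≤ Real.exp (2 * π * t * Y) * (C * Real.exp (a * |Y|) / (1 + x ^ 2)) := by gcongr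
          _ = C * (Real.exp (2 * π * t * Y) * Real.exp (a * |Y|)) * (1 + x ^ 2)⁻¹ := by ring
          _ = _ := by
            rw [← Real.exp_add, hYn, mul_assoc (2 * π), hYt]; ring_nf
      refine (norm_integral_le_of_norm_le ((integrable_inv_one_add_sq).const_mul _)
        (Eventually.of_forall this)).trans ?_
      rw [integral_const_mul, integral_univ_inv_one_add_sq]
      apply le_of_eq; ring
    · intro z hz
      rw [hGn]
      have h1 : Real.exp (2 * π * t * z.im) ≤ Real.exp (2 * π * |t| * |Y|) := by
        apply Real.exp_le_exp.mpr
        rw [mul_assoc (2 * π), mul_assoc (2 * π)]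
        have : t * z.im ≤ |t| * |Y| := (le_abs_self _).trans (by rw [abs_mul]; gcongr)
        gcongr
      have h2 : ‖H z‖ ≤ C * Real.exp (a * |Y|) / (1 + z.re ^ 2) := by
        refine (hb z).trans ?_
        gcongr
      calc _ ≤ Real.exp (2 * π * |t| * |Y|) * (C * Real.exp (a * |Y|) / (1 + z.re ^ 2)) := by gcongr
        _ = _ := by ring
  have hlim : Tendsto (fun n : ℕ => (C * π) * Real.exp (-(2 * π * |t| - a) * n)) atTop (nhds 0) := by
    rw [← mul_zero (C * π)]
    apply Tendsto.const_mul
    apply Real.tendsto_exp_atBot.comp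
    apply Tendsto.const_mul_atTop_of_neg (by linarith) tendsto_natCast_atTop_atTop
  have := ge_of_tendsto' hlim hmain
  exact norm_le_zero_iff.mp this

open FourierTransform in
lemma poisson_finite (H : ℂ → ℂ) (hH : Differentiable ℂ H) (a C : ℝ) (ha : 0 ≤ a)
    (hb : ∀ z : ℂ, ‖H z‖ ≤ C * Real.exp (a * |z.im|) / (1 + z.re ^ 2))
    (N : ℕ) (hN : 1 ≤ N) (m : ℕ) (hm : a * N < 2 * π * (m + 1)) :
    ∃ c : ℤ → ℂ, ∀ x : ℝ, ∑' k : ℤ, H ((x + k * N : ℝ)) =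
      ∑ n ∈ Finset.Icc (-m : ℤ) m, c n * Complex.exp (2 * π * I * n * (x / N : ℝ)) := by
  have hC : 0 ≤ C := by
    have := (norm_nonneg _).trans (hb 0)
    simpa using this
  have hN0 : (0:ℝ) < N := by exact_mod_cast hN
  set H' : ℂ → ℂ := fun z => H (N * z) with hH'
  have hH'd : Differentiable ℂ H' := hH.comp (by fun_prop)
  have hb' : ∀ z : ℂ, ‖H' z‖ ≤ C * Real.exp ((a * N) * |z.im|) / (1 + z.re ^ 2) := by
    intro z
    refine (hb _).trans ?_
    have e1 : ((N:ℂ) * z).im = N * z.im := by simp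
    have e2 : ((N:ℂ) * z).re = N * z.re := by simp
    rw [e1, e2, abs_mul, abs_of_pos hN0, ← mul_assoc]
    apply div_le_div_of_nonneg_left (by positivity) (by positivity)
    rw [mul_pow]
    have : (1:ℝ) ≤ N ^ 2 := by
      have : (1:ℝ) ≤ N := by exact_mod_cast hN
      nlinarith
    nlinarith [sq_nonneg z.re]
  set f : ℝ → ℂ := fun x => H' x with hf
  have hz : ∀ n : ℤ, n ∉ Finset.Icc (-m : ℤ) m → 𝓕 f n = 0 := by
    intro n hn
    apply fourier_vanish H' hH'd (a * N) C (by positivity) hb'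
    have h1 : (m:ℤ) + 1 ≤ |n| := by
      simp only [Finset.mem_Icc, not_and_or, not_le] at hn
      rcases hn with h | h
      · have := neg_le_abs n; omega
      · have := le_abs_self n; omega
    have h2 : (m:ℝ) + 1 ≤ |(n:ℝ)| := by exact_mod_cast h1
    refine hm.trans_le ?_
    gcongr
  refine ⟨fun n => 𝓕 f n, ?_⟩
  intro x
  have hP := Real.tsum_eq_tsum_fourier_of_rpow_decay_of_summable (f := f)
    (hH'd.continuous.comp continuous_ofReal) (b := 2) (by norm_num) ?_
    (summable_of_ne_finset_zero (s := Finset.Icc (-m : ℤ) m) hz) (x / N)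
  · rw [tsum_eq_sum (f := fun n : ℤ => 𝓕 f n * (_root_.fourier n) ((x / N : ℝ) : UnitAddCircle))
      (s := Finset.Icc (-m : ℤ) m) (fun n hn => by rw [hz n hn, zero_mul])] at hP
    have e1 : (fun k : ℤ => H ((x + k * N : ℝ))) = fun n : ℤ => f (x / N + n) := by
      ext k
      simp only [hf, hH']
      congr 1
      have hNc : (N:ℂ) ≠ 0 := by exact_mod_cast hN0.ne'
      push_cast
      field_simp
    rw [e1, hP]
    apply Finset.sum_congr rfl
    intro n _
    rw [fourier_coe_apply]
    congr 2
    push_cast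
    simp
  · apply Asymptotics.IsBigO.of_bound C
    have : ∀ᶠ x : ℝ in cocompact ℝ, x ≠ 0 := by
      have := (isCompact_singleton (x := (0:ℝ))).compl_mem_cocompact
      filter_upwards [this] with x hx using hx
    filter_upwards [this] with x hx
    have h := hb' x
    simp at h
    rw [Real.norm_eq_abs, abs_of_nonneg (by positivity)]
    refine h.trans ?_
    rw [Real.rpow_neg (abs_nonneg _), div_eq_mul_inv]
    have : |x| ^ (2:ℝ) = x ^ 2 := by
      rw [Real.rpow_two, sq_abs]
    rw [this]
    have : 0 < x ^ 2 := by positivity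
    gcongr
    linarith

open Polynomial in
lemma exists_factor (H : ℂ → ℂ) (hH : Differentiable ℂ H) (a C : ℝ) (ha : 0 ≤ a)
    (hb : ∀ z : ℂ, ‖H z‖ ≤ C * Real.exp (a * |z.im|) / (1 + z.re ^ 2))
    (h : ℝ → ℝ) (hh : ∀ x : ℝ, H x = (h x : ℂ)) (hpos : ∀ x, 0 ≤ h x)
    (N : ℕ) (hN : 1 ≤ N) (m : ℕ) (hm : a * N < 2 * π * (m + 1)) (ε : ℝ) (hε : 0 < ε) :
    ∃ p : ℂ[X], p.natDegree ≤ m ∧ ∀ x : ℝ,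
      (∑' k : ℤ, h (x + k * N)) + ε = ‖p.eval (Complex.exp (2 * π * I * (x / N : ℝ)))‖ ^ 2 := by
  obtain ⟨c, hc⟩ := poisson_finite H hH a C ha hb N hN m hm
  have hN0 : (0:ℝ) < N := by exact_mod_cast hN
  set q : ℂ[X] := (∑ n ∈ Finset.Icc (-m : ℤ) m, Polynomial.C (c n) * X ^ (n + m).toNat)
    + Polynomial.C (ε : ℂ) * X ^ m with hq
  have hqd : q.natDegree ≤ 2 * m := by
    rw [hq]
    apply natDegree_add_le_of_degree_le
    · apply natDegree_sum_le_of_forall_le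
      intro n hn
      refine (natDegree_C_mul_X_pow_le _ _).trans ?_
      rw [Finset.mem_Icc] at hn
      omega
    · refine (natDegree_C_mul_X_pow_le _ _).trans ?_
      omega
  have hqe : ∀ x : ℝ, q.eval (Complex.exp (2 * π * I * (x / N : ℝ))) =
      (((∑' k : ℤ, h (x + k * N)) + ε : ℝ) : ℂ) * (Complex.exp (2 * π * I * (x / N : ℝ))) ^ m := by
    intro x
    have h1 := hc x
    simp only [hh] at h1
    rw [← Complex.ofReal_tsum] at h1
    rw [hq, eval_add, eval_finsetSum]
    push_cast at h1 ⊢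
    rw [h1, add_mul, Finset.sum_mul]
    congr 1
    · apply Finset.sum_congr rfl
      intro n hn
      rw [Finset.mem_Icc] at hn
      simp only [eval_mul, eval_C, eval_pow, eval_X]
      rw [mul_assoc (c n) (cexp _) _, ← Complex.exp_nat_mul, ← Complex.exp_nat_mul, ← Complex.exp_add]
      congr 2
      have : (((n + m).toNat : ℤ) : ℂ) = ((n + m : ℤ) : ℂ) := by
        rw [Int.toNat_of_nonneg (by omega)]
      have h2 : (((n + m).toNat : ℕ) : ℂ) = n + m := by
        rw [← Int.cast_natCast, this]; push_cast; ring
      rw [h2]; ring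
    · simp
  have hpos' : ∀ x : ℝ, 0 < (∑' k : ℤ, h (x + k * N)) + ε := by
    intro x
    have : 0 ≤ ∑' k : ℤ, h (x + k * N) := tsum_nonneg (fun k => hpos _)
    linarith
  have hcirc : ∀ z : ℂ, ‖z‖ = 1 → ∃ x : ℝ, z = Complex.exp (2 * π * I * (x / N : ℝ)) := by
    intro z hz
    refine ⟨N * (Complex.arg z / (2 * π)), ?_⟩
    have := Complex.norm_mul_exp_arg_mul_I z
    rw [hz, Complex.ofReal_one, one_mul] at this
    rw [← this, this]
    conv_lhs => rw [← this]
    congr 1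
    have hpi : (π:ℂ) ≠ 0 := by exact_mod_cast Real.pi_ne_zero
    have hNc : (N:ℂ) ≠ 0 := by exact_mod_cast hN0.ne'
    push_cast
    field_simp
  obtain ⟨p, hp, hpe⟩ := fejer_riesz m q hqd (by
    intro z hz
    obtain ⟨x, rfl⟩ := hcirc z hz
    exact ⟨_, hpos' x, hqe x⟩)
  refine ⟨p, hp, ?_⟩
  intro x
  have hn : ‖Complex.exp (2 * π * I * (x / N : ℝ))‖ = 1 := by
    have : (2 * π * I * (x / N : ℝ) : ℂ) = ((2 * π * (x / N) : ℝ) : ℂ) * I := by push_cast; ring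
    rw [this, Complex.norm_exp_ofReal_mul_I]
  have h1 := hpe _ hn
  rw [hqe x] at h1
  have h2 := mul_right_cancel₀ (pow_ne_zero _ (Complex.exp_ne_zero _)) h1
  exact_mod_cast h2

end


/-- The interval of frequencies. -/
noncomputable def II : Set ℝ := Set.Icc (-(1/2)) (1/2)

/-- Truncation to the interval. -/
noncomputable def trunc (p : ℝ → ℂ) : ℝ → ℂ := II.indicator p

/-- The hat function. -/
noncomputable def hat (u : ℝ) : ℝ := max (1 - |u|) 0

lemma trunc_integrable (p : ℝ → ℂ) (hp : Continuous p) : Integrable (trunc p) :=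
  (integrable_indicator_iff measurableSet_Icc).mpr (hp.continuousOn.integrableOn_Icc)

lemma trunc_bdd (p : ℝ → ℂ) (hp : Continuous p) : ∃ C, ∀ t, ‖trunc p t‖ ≤ C := by
  obtain ⟨C, hC⟩ := (isCompact_Icc (a := -(1/2:ℝ)) (b := 1/2)).exists_bound_of_continuousOn
    hp.continuousOn
  refine ⟨max C 0, fun t => ?_⟩
  unfold trunc
  by_cases h : t ∈ II
  · rw [Set.indicator_of_mem h]; exact (hC t h).trans (le_max_left _ _)
  · rw [Set.indicator_of_notMem h]; simp

lemma integral_trunc (p : ℝ → ℂ) : ∫ t, trunc p t = ∫ t in II, p t :=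
  integral_indicator measurableSet_Icc

lemma setII (p : ℝ → ℂ) : ∫ t in II, p t = ∫ t in (-(1/2):ℝ)..(1/2), p t := by
  rw [intervalIntegral.integral_of_le (by norm_num), II, integral_Icc_eq_integral_Ioc]

open FourierTransform in
lemma fourier_trunc (p : ℝ → ℂ) (x : ℝ) :
    𝓕 (trunc p) x = ∫ t in II, Complex.exp (-(2 * π * x * t) * I) * p t := by
  rw [Real.fourier_eq', ← integral_indicator (show MeasurableSet II from measurableSet_Icc)]
  congr 1
  ext t
  unfold trunc
  by_cases h : t ∈ II
  · rw [Set.indicator_of_mem h, Set.indicator_of_mem h]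
    simp only [smul_eq_mul]
    congr 2
    simp
    ring
  · rw [Set.indicator_of_notMem h, Set.indicator_of_notMem h]; simp

lemma integral_exp_II (y : ℂ) : ∫ t in II, Complex.exp (2 * y * t * I) = csinc y := by
  rw [setII]
  unfold csinc
  split_ifs with h
  · subst h; simp; norm_num
  · have hc : (2 * y * I) ≠ 0 := by simp [h]
    have : ∀ t : ℝ, Complex.exp (2 * y * t * I) = Complex.exp ((2 * y * I) * t) := by
      intro t; congr 1; ring
    simp_rw [this]
    rw [integral_exp_mul_complex hc, Complex.sin]
    have hI : I ≠ 0 := I_ne_zero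
    push_cast
    have e1 : 2 * y * I * (1/2) = y * I := by ring
    have e2 : 2 * y * I * -(1/2) = -y * I := by ring
    rw [e1, e2]
    field_simp
    linear_combination (cexp (y*I) - cexp (-(y*I))) * I_sq

lemma hat_eq_conv (u : ℝ) :
    convolution (trunc (fun _ => 1)) (trunc (fun _ => 1)) (ContinuousLinearMap.mul ℂ ℂ) volume u
      = (hat u : ℂ) := by
  rw [convolution]
  have : ∀ t, (ContinuousLinearMap.mul ℂ ℂ) (trunc (fun _ => 1) t) (trunc (fun _ => 1) (u - t))
      = (Set.Icc (max (-(1/2)) (u - 1/2)) (min (1/2) (u + 1/2))).indicator (fun _ => (1:ℂ)) t := by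
    intro t
    rw [← Set.Icc_inter_Icc]
    have h2 : (u - t ∈ II) ↔ t ∈ Set.Icc (u - 1/2) (u + 1/2) := by
      simp only [II, Set.mem_Icc]; constructor <;> rintro ⟨h, h'⟩ <;> constructor <;> linarith
    unfold trunc
    have h3 : t ∈ II ↔ t ∈ Set.Icc (-(1/2):ℝ) (1/2) := Iff.rfl
    rw [ContinuousLinearMap.mul_apply']
    by_cases ha : t ∈ Set.Icc (-(1/2):ℝ) (1/2)
    · by_cases hb : t ∈ Set.Icc (u - 1/2) (u + 1/2)
      · rw [Set.indicator_of_mem (h3.mpr ha), Set.indicator_of_mem (h2.mpr hb),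
          Set.indicator_of_mem (Set.mem_inter ha hb), mul_one]
      · rw [Set.indicator_of_notMem (s := II) (a := u - t) (fun h => hb (h2.mp h)), mul_zero,
          Set.indicator_of_notMem (fun h => hb (Set.mem_of_mem_inter_right h))]
    · rw [Set.indicator_of_notMem (s := II) (a := t) (fun h => ha (h3.mp h)), zero_mul,
          Set.indicator_of_notMem (fun h => ha (Set.mem_of_mem_inter_left h))]
  simp_rw [this]
  rw [integral_indicator measurableSet_Icc]
  simp only [integral_const, measureReal_restrict_apply_univ, Real.volume_real_Icc]
  simp only [real_smul, mul_one, hat]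
  congr 2
  rcases le_total 0 u with h | h
  · rw [abs_of_nonneg h, min_eq_left (by linarith), max_eq_right (by linarith)]; ring
  · rw [abs_of_nonpos h, min_eq_right (by linarith), max_eq_left (by linarith)]; ring

lemma hat_cont : Continuous hat := by unfold hat; fun_prop

lemma hat_bounds (u : ℝ) : 0 ≤ hat u ∧ hat u ≤ 1 := by
  unfold hat
  refine ⟨le_max_right _ _, max_le ?_ (by norm_num)⟩
  have := abs_nonneg u; linarith

lemma hat_conv_fun : (fun u => (hat u : ℂ)) =
    convolution (trunc (fun _ => 1)) (trunc (fun _ => 1)) (ContinuousLinearMap.mul ℂ ℂ) volume := by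
  ext u; rw [hat_eq_conv]

lemma hat_integrable : Integrable (fun u => (hat u : ℂ)) := by
  rw [hat_conv_fun]
  exact Integrable.integrable_convolution _ (trunc_integrable _ continuous_const)
    (trunc_integrable _ continuous_const)

lemma csinc_even (z : ℂ) : csinc (-z) = csinc z := by
  unfold csinc; simp

open FourierTransform in
lemma fourier_rect (x : ℝ) : 𝓕 (trunc (fun _ => 1)) x = csinc (π * x) := by
  rw [fourier_trunc, ← csinc_even, ← integral_exp_II]
  congr 1; ext t; rw [mul_one]; congr 1; ring

open FourierTransform in
lemma fourier_hat (x : ℝ) : 𝓕 (fun u => (hat u : ℂ)) x = csinc (π * x) ^ 2 := by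
  rw [hat_conv_fun, Real.fourier_mul_convolution_eq (trunc_integrable _ continuous_const)
    (trunc_integrable _ continuous_const), fourier_rect, sq]

lemma csinc_real (y : ℝ) : csinc y = ((Real.sinc y : ℝ) : ℂ) := by
  unfold csinc Real.sinc
  split_ifs with h h' h' <;> simp_all

lemma sinc_sq_bound (y : ℝ) : Real.sinc y ^ 2 ≤ 2 / (1 + y ^ 2) := by
  have h1 : |Real.sinc y| ≤ 1 := Real.abs_sinc_le_one y
  have h2 : (Real.sinc y * y) ^ 2 ≤ 1 := by
    by_cases h : y = 0
    · subst h; simp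
    · rw [Real.sinc_of_ne_zero h, div_mul_cancel₀ _ h]; exact Real.sin_sq_le_one y
  have h3 : Real.sinc y ^ 2 ≤ 1 := by rw [← sq_abs]; exact pow_le_one₀ (abs_nonneg _) h1
  rw [le_div_iff₀ (by positivity)]
  nlinarith

lemma w_ae : ∀ᵐ x : ℝ, pairCorKernel x = 1 - Real.sinc (π * x) ^ 2 := by
  have : ∀ᵐ x : ℝ, x ≠ 0 := by
    rw [ae_iff]; simp
  filter_upwards [this] with x hx
  rw [pairCorKernel, Real.sinc_of_ne_zero (by positivity)]

lemma w_nonneg (x : ℝ) : 0 ≤ pairCorKernel x := by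
  unfold pairCorKernel
  have : |Real.sin (π * x) / (π * x)| ≤ 1 := by
    by_cases h : π * x = 0
    · rw [h]; simp
    · rw [← Real.sinc_of_ne_zero h]; exact Real.abs_sinc_le_one _
  have := (sq_le_one_iff_abs_le_one _).mpr this
  linarith

lemma w_le_one (x : ℝ) : pairCorKernel x ≤ 1 := by
  unfold pairCorKernel
  have := sq_nonneg (Real.sin (π * x) / (π * x))
  linarith

lemma w_meas : Measurable pairCorKernel := by
  unfold pairCorKernel; fun_prop

open FourierTransform in
lemma fourier_cont (p : ℝ → ℂ) (hp : Continuous p) : Continuous (𝓕 (trunc p)) :=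
  VectorFourier.fourierIntegral_continuous Real.continuous_fourierChar
    (by exact continuous_inner) (trunc_integrable p hp)

open FourierTransform ComplexConjugate in
lemma parseval_cont (G : ℝ → ℂ) (hG : Integrable G) (Q : ℝ → ℂ) (hQc : Continuous Q)
    (hQ : Integrable Q) (hFQ : Integrable (𝓕 Q)) :
    ∫ x, conj (𝓕 G x) * 𝓕 Q x = ∫ t, conj (G t) * Q t := by
  have h := VectorFourier.integral_sesq_fourierIntegral_eq_neg_flip (innerSL ℂ)
    (μ := (volume : Measure ℝ)) (ν := (volume : Measure ℝ)) (L := innerₗ ℝ)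
    Real.continuous_fourierChar (by exact continuous_inner) hG hFQ
  have h2 := hQc.fourierInv_fourier_eq hQ hFQ
  have e : ∀ x, VectorFourier.fourierIntegral Real.fourierChar volume (-(innerₗ ℝ).flip) (𝓕 Q) x
      = Q x := by
    intro x
    conv_rhs => rw [← h2]
    rw [Real.fourierInv_eq]
    unfold VectorFourier.fourierIntegral
    congr 1; ext v
    simp
  have e3 : VectorFourier.fourierIntegral Real.fourierChar volume (innerₗ ℝ) G = 𝓕 G := rfl
  simp only [e, e3, innerSL_apply_apply, RCLike.inner_apply'] at h
  exact h


open FourierTransform ComplexConjugate in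
lemma fourier_conj_neg (G : ℝ → ℂ) (x : ℝ) :
    𝓕 (fun t => conj (G (-t))) x = conj (𝓕 G x) := by
  rw [Real.fourier_eq', Real.fourier_eq', ← integral_conj, ← integral_neg_eq_self]
  congr 1; ext t
  have h2 : conj (2:ℂ) = 2 := Complex.conj_ofNat 2
  simp [← Complex.exp_conj, h2]

lemma trunc_continuousAt (q : ℝ → ℂ) (hq : Continuous q) (t : ℝ) (h1 : t ≠ 1/2) (h2 : t ≠ -(1/2)) :
    ContinuousAt (trunc q) t := by
  apply hq.continuousOn.continuousAt_indicator
  rw [II, frontier_Icc (by norm_num)]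
  simp only [Set.mem_insert_iff, Set.mem_singleton_iff, not_or]
  exact ⟨h2, h1⟩

open FourierTransform ComplexConjugate in
lemma parseval_trunc (p q : ℝ → ℂ) (hp : Continuous p) (hq : Continuous q)
    (hintg : Integrable (fun x => 𝓕 (trunc p) x * conj (𝓕 (trunc q) x))) :
    ∫ x, 𝓕 (trunc p) x * conj (𝓕 (trunc q) x) = ∫ t in II, p t * conj (q t) := by
  set G2 : ℝ → ℂ := fun t => conj (trunc q (-t)) with hG2
  have hG2i : Integrable G2 := by
    have := (trunc_integrable q hq).comp_neg
    exact (Complex.conjCLE.toContinuousLinearMap.integrable_comp this)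
  have hG1i := trunc_integrable p hp
  set a := convolution (trunc p) G2 (ContinuousLinearMap.mul ℂ ℂ) volume with ha
  have hai : Integrable a := hG1i.integrable_convolution _ hG2i
  have hFa : 𝓕 a = fun x => 𝓕 (trunc p) x * conj (𝓕 (trunc q) x) := by
    ext x
    rw [ha, Real.fourier_mul_convolution_eq hG1i hG2i, hG2, fourier_conj_neg]
  obtain ⟨C, hC⟩ := trunc_bdd q hq
  have hac : ContinuousAt a 0 := by
    have : a = fun u => ∫ t, trunc p t * conj (trunc q (t - u)) := by
      ext u; rw [ha, convolution]; simp [hG2]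
    rw [this]
    apply continuousAt_of_dominated (bound := fun t => ‖trunc p t‖ * C)
    · refine Eventually.of_forall fun u => ?_
      have := (Complex.conjCLE.toContinuousLinearMap.integrable_comp
        ((trunc_integrable q hq).comp_sub_right u))
      exact hG1i.aestronglyMeasurable.mul this.aestronglyMeasurable
    · refine Eventually.of_forall fun u => Eventually.of_forall fun t => ?_
      rw [norm_mul, RCLike.norm_conj]
      gcongr
      exact hC _
    · exact hG1i.norm.mul_const C
    · have : ∀ᵐ t : ℝ, t ≠ 1/2 ∧ t ≠ -(1/2) := by
        have h1 : ∀ᵐ t : ℝ, t ≠ 1/2 := by rw [ae_iff]; simp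
        have h2 : ∀ᵐ t : ℝ, t ≠ -(1/2) := by rw [ae_iff]; simp
        filter_upwards [h1, h2] with t a b using ⟨a, b⟩
      filter_upwards [this] with t ht
      have hc := trunc_continuousAt q hq t ht.1 ht.2
      refine continuousAt_const.mul (Complex.continuous_conj.continuousAt.comp ?_)
      have : ContinuousAt (trunc q) (t - 0) := by rw [sub_zero]; exact hc
      exact ContinuousAt.comp (f := fun u => t - u) this (by fun_prop)
  have h := hai.fourierInv_fourier_eq (by rw [hFa]; exact hintg) hac
  rw [Real.fourierInv_eq, hFa] at h
  simp only [inner_zero_right, AddChar.map_zero_eq_one, one_smul] at h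
  rw [h, ha, convolution, ← integral_indicator (show MeasurableSet II from measurableSet_Icc)]
  congr 1; ext t
  simp only [hG2, ContinuousLinearMap.mul_apply', zero_sub, neg_neg, trunc]
  by_cases ht : t ∈ II
  · simp [Set.indicator_of_mem ht]
  · simp [Set.indicator_of_notMem ht]

open FourierTransform ComplexConjugate in
lemma rk1 (p q : ℝ → ℂ) (hp : Continuous p) (hq : Continuous q)
    (hintg : Integrable (fun x => 𝓕 (trunc p) x * conj (𝓕 (trunc q) x))) :
    ∫ x, 𝓕 (trunc p) x * conj (𝓕 (trunc q) x) * (pairCorKernel x : ℂ) =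
      ∫ s in II, conj (conj (p s) * (q s - ∫ t in II, (1 - |s - t| : ℝ) * q t)) := by
  set Q := convolution (trunc q) (fun u => (hat u : ℂ)) (ContinuousLinearMap.mul ℂ ℂ) volume with hQ
  have hqi := trunc_integrable q hq
  have hpi := trunc_integrable p hp
  have hQi : Integrable Q := hqi.integrable_convolution _ hat_integrable
  have hQc : Continuous Q := by
    apply BddAbove.continuous_convolution_right_of_integrable
    · refine ⟨1, ?_⟩
      rintro _ ⟨x, rfl⟩
      simp only [Complex.norm_real, Real.norm_eq_abs, abs_of_nonneg (hat_bounds x).1]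
      exact (hat_bounds x).2
    · exact hqi
    · exact Complex.continuous_ofReal.comp hat_cont
  have hFQ : 𝓕 Q = fun x => 𝓕 (trunc q) x * ((Real.sinc (π * x) ^ 2 : ℝ) : ℂ) := by
    ext x
    rw [hQ, Real.fourier_mul_convolution_eq hqi hat_integrable, fourier_hat]
    have := csinc_real (π * x)
    push_cast at this ⊢
    rw [this]
  have hcont := fourier_cont q hq
  have hcontp := fourier_cont p hp
  have hsc : Continuous (fun x : ℝ => Real.sinc (π * x) ^ 2) := by
    have := Real.continuous_sinc
    fun_prop
  have hsi : Integrable (fun x : ℝ => Real.sinc (π * x) ^ 2) := by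
    have h1 : Integrable (fun x : ℝ => 2 * (1 + (π * x) ^ 2)⁻¹) :=
      (integrable_inv_one_add_sq.comp_mul_left' (R := π) Real.pi_ne_zero).const_mul 2
    refine h1.mono' hsc.aestronglyMeasurable (Eventually.of_forall fun x => ?_)
    rw [Real.norm_eq_abs, abs_of_nonneg (by positivity)]
    simpa [div_eq_mul_inv] using sinc_sq_bound (π * x)
  have hFbd : ∀ x, ‖𝓕 (trunc q) x‖ ≤ ∫ t, ‖trunc q t‖ :=
    fun x => VectorFourier.norm_fourierIntegral_le_integral_norm _ _ _ _ _
  have hFQi : Integrable (𝓕 Q) := by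
    rw [hFQ]
    have h1 : Integrable (fun x : ℝ => ((Real.sinc (π * x) ^ 2 : ℝ) : ℂ)) := hsi.ofReal
    exact h1.bdd_mul hcont.aestronglyMeasurable (Eventually.of_forall hFbd)
  have hP := parseval_cont (trunc p) hpi Q hQc hQi hFQi
  have hi2 : Integrable (fun x => 𝓕 (trunc p) x * conj (𝓕 (trunc q) x) *
      ((Real.sinc (π * x) ^ 2 : ℝ) : ℂ)) := by
    refine hintg.mul_bdd (c := 1) (Complex.continuous_ofReal.comp hsc).aestronglyMeasurable
      (Eventually.of_forall fun x => ?_)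
    rw [Complex.norm_real, Real.norm_eq_abs, abs_pow]
    exact pow_le_one₀ (abs_nonneg _) (Real.abs_sinc_le_one _)
  have e1 : ∫ x, 𝓕 (trunc p) x * conj (𝓕 (trunc q) x) * (pairCorKernel x : ℂ) =
      (∫ x, 𝓕 (trunc p) x * conj (𝓕 (trunc q) x)) -
       ∫ x, 𝓕 (trunc p) x * conj (𝓕 (trunc q) x) * ((Real.sinc (π * x) ^ 2 : ℝ) : ℂ) := by
    rw [← integral_sub hintg hi2]
    apply integral_congr_ae
    filter_upwards [w_ae] with x hx
    rw [hx]; push_cast; ring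
  have e2 : ∫ x, 𝓕 (trunc p) x * conj (𝓕 (trunc q) x) * ((Real.sinc (π * x) ^ 2 : ℝ) : ℂ)
      = conj (∫ x, conj (𝓕 (trunc p) x) * 𝓕 Q x) := by
    rw [← integral_conj]
    congr 1; ext x
    rw [hFQ]; simp [mul_assoc]
  have e3 : conj (∫ t, conj (trunc p t) * Q t) = ∫ s in II, p s * conj (Q s) := by
    rw [← integral_conj, ← integral_indicator (show MeasurableSet II from measurableSet_Icc)]
    congr 1; ext t
    unfold trunc
    by_cases ht : t ∈ II
    · simp [Set.indicator_of_mem ht]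
    · simp [Set.indicator_of_notMem ht]
  have e4 : ∀ s ∈ II, Q s = ∫ t in II, (1 - |s - t| : ℝ) * q t := by
    intro s hs
    rw [hQ, convolution, ← integral_indicator (show MeasurableSet II from measurableSet_Icc)]
    congr 1; ext t
    rw [ContinuousLinearMap.mul_apply', trunc]
    by_cases ht : t ∈ II
    · rw [Set.indicator_of_mem ht, Set.indicator_of_mem ht, hat, max_eq_left, mul_comm]
      simp only [II, Set.mem_Icc] at hs ht
      have : |s - t| ≤ 1 := by rw [abs_le]; constructor <;> linarith
      linarith
    · simp [Set.indicator_of_notMem ht]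
  rw [e1, e2, hP, e3, parseval_trunc p q hp hq hintg, ← integral_sub]
  · apply setIntegral_congr_fun measurableSet_Icc
    intro s hs
    simp only
    rw [e4 s hs]
    simp only [map_mul, map_sub, RCLike.conj_conj]
    simp; ring
  · exact (Continuous.continuousOn (by fun_prop)).integrableOn_Icc
  · exact (Continuous.continuousOn (by fun_prop)).integrableOn_Icc


lemma csinc_differentiable : Differentiable ℂ csinc := by
  have : csinc = dslope Complex.sin 0 := by
    ext z
    unfold csinc
    split_ifs with h
    · subst h; simp
    · rw [dslope_of_ne _ h, slope_def_field]; simp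
  rw [this]
  intro z
  have := (Complex.differentiableOn_dslope (f := Complex.sin) (s := Set.univ) (c := 0)
    Filter.univ_mem).mpr (Complex.differentiable_sin.differentiableOn)
  exact this.differentiableAt Filter.univ_mem

lemma csinc_bound (z : ℂ) : ‖csinc z‖ ≤ Real.exp |z.im| := by
  rw [← integral_exp_II, setII]
  have := intervalIntegral.norm_integral_le_of_norm_le_const (a := -(1/2:ℝ)) (b := 1/2)
    (f := fun t : ℝ => Complex.exp (2 * z * t * I)) (C := Real.exp |z.im|) ?_
  · refine this.trans (le_of_eq ?_)
    norm_num
  · intro t ht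
    rw [Set.uIoc_of_le (by norm_num)] at ht
    rw [Complex.norm_exp]
    apply Real.exp_le_exp.mpr
    have : (2 * z * t * I).re = - (2 * t) * z.im := by simp; ring
    rw [this]
    refine (le_abs_self _).trans ?_
    rw [abs_mul]
    have h1 : |-(2 * t)| ≤ 1 := by rw [abs_le]; constructor <;> linarith [ht.1, ht.2]
    nlinarith [abs_nonneg z.im]

lemma csin_bound (z : ℂ) : ‖Complex.sin z‖ ≤ Real.exp |z.im| := by
  rw [Complex.sin, norm_div, norm_mul, Complex.norm_I, mul_one]
  have h1 : ‖Complex.exp (-z * I)‖ ≤ Real.exp |z.im| := by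
    rw [Complex.norm_exp]; apply Real.exp_le_exp.mpr; simp [le_abs_self]
  have h2 : ‖Complex.exp (z * I)‖ ≤ Real.exp |z.im| := by
    rw [Complex.norm_exp]; apply Real.exp_le_exp.mpr; simp [neg_le_abs]
  have h3 := norm_sub_le (Complex.exp (-z * I)) (Complex.exp (z * I))
  simp only [Complex.norm_ofNat]
  linarith

lemma csinc_sq_bound (z : ℂ) : ‖csinc z‖ ^ 2 ≤ 2 * Real.exp (2 * |z.im|) / (1 + z.re ^ 2) := by
  rw [le_div_iff₀ (by positivity)]
  have h1 : ‖csinc z‖ ^ 2 ≤ Real.exp (2 * |z.im|) := by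
    have := pow_le_pow_left₀ (norm_nonneg _) (csinc_bound z) 2
    rwa [← Real.exp_nat_mul] at this
  have h2 : (‖csinc z‖ * ‖z‖) ^ 2 ≤ Real.exp (2 * |z.im|) := by
    have h3 : ‖csinc z‖ * ‖z‖ ≤ Real.exp |z.im| := by
      rw [← norm_mul]
      by_cases h : z = 0
      · subst h; simp
      · have : csinc z * z = Complex.sin z := by
          unfold csinc; rw [if_neg h, div_mul_cancel₀ _ h]
        rw [this]; exact csin_bound z
    have := pow_le_pow_left₀ (by positivity) h3 2
    rwa [← Real.exp_nat_mul] at this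
  have h4 : z.re ^ 2 ≤ ‖z‖ ^ 2 := by
    rw [← sq_abs z.re]; exact pow_le_pow_left₀ (abs_nonneg _) (Complex.abs_re_le_norm z) 2
  have h5 := mul_le_mul_of_nonneg_left h4 (sq_nonneg ‖csinc z‖)
  rw [mul_pow] at h2
  nlinarith

/-- Square decay on the real line. -/
def Dec (F : ℝ → ℂ) : Prop := Continuous F ∧ ∃ C, ∀ x : ℝ, ‖F x‖ ^ 2 ≤ C / (1 + x ^ 2)

lemma Dec.const_mul {F : ℝ → ℂ} (h : Dec F) (c : ℂ) : Dec (fun x => c * F x) := by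
  obtain ⟨h1, C, hC⟩ := h
  refine ⟨by fun_prop, ‖c‖ ^ 2 * C, fun x => ?_⟩
  rw [norm_mul, mul_pow, mul_div_assoc]
  gcongr
  exact hC x

lemma Dec.add {F G : ℝ → ℂ} (h : Dec F) (h' : Dec G) : Dec (fun x => F x + G x) := by
  obtain ⟨h1, C, hC⟩ := h
  obtain ⟨h1', C', hC'⟩ := h'
  refine ⟨by fun_prop, 2 * C + 2 * C', fun x => ?_⟩
  have h2 := pow_le_pow_left₀ (norm_nonneg _) (norm_add_le (F x) (G x)) 2
  have h3 : (2 * C + 2 * C') / (1 + x ^ 2) = 2 * (C / (1 + x ^ 2)) + 2 * (C' / (1 + x ^ 2)) := by ring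
  rw [h3]
  nlinarith [hC x, hC' x, sq_nonneg (‖F x‖ - ‖G x‖)]

open ComplexConjugate in
lemma Dec.integrable {F G : ℝ → ℂ} (h : Dec F) (h' : Dec G) :
    Integrable (fun x => F x * conj (G x)) := by
  obtain ⟨h1, C, hC⟩ := h
  obtain ⟨h1', C', hC'⟩ := h'
  refine Integrable.mono' ((integrable_inv_one_add_sq).const_mul (C + C'))
    (Continuous.aestronglyMeasurable (by fun_prop)) (Eventually.of_forall fun x => ?_)
  rw [norm_mul, RCLike.norm_conj]
  have := hC x
  have := hC' x
  have h3 : (C + C') * (1 + x ^ 2)⁻¹ = (C / (1 + x ^ 2)) + (C' / (1 + x ^ 2)) := by ring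
  rw [h3]
  nlinarith [sq_nonneg (‖F x‖ - ‖G x‖), sq_nonneg (‖F x‖), sq_nonneg (‖G x‖)]

open ComplexConjugate in
lemma Dec.integrable_w {F G : ℝ → ℂ} (h : Dec F) (h' : Dec G) :
    Integrable (fun x => F x * conj (G x) * (pairCorKernel x : ℂ)) := by
  refine (h.integrable h').mul_bdd (c := 1)
    (Complex.measurable_ofReal.comp w_meas).aestronglyMeasurable (Eventually.of_forall fun x => ?_)
  rw [Complex.norm_real, Real.norm_eq_abs, abs_of_nonneg (w_nonneg x)]
  exact w_le_one x

lemma dec_csinc (u : ℝ) : Dec (fun x => csinc (u - π * x)) := by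
  refine ⟨csinc_differentiable.continuous.comp (by fun_prop), 4 * (1 + u ^ 2), fun x => ?_⟩
  have h := csinc_sq_bound (u - π * x)
  have e1 : ((u:ℂ) - π * x).im = 0 := by simp
  have e2 : ((u:ℂ) - π * x).re = u - π * x := by simp
  rw [e1, e2, abs_zero, mul_zero, Real.exp_zero, mul_one] at h
  refine h.trans ?_
  rw [div_le_div_iff₀ (by positivity) (by positivity)]
  have hpi : (1:ℝ) ≤ π ^ 2 := by nlinarith [Real.pi_gt_three]
  have h1 : x ^ 2 ≤ (π * x) ^ 2 := by rw [mul_pow]; nlinarith [sq_nonneg x]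
  nlinarith [sq_nonneg (u * (u - π * x)), sq_nonneg (u + (u - π * x)), sq_nonneg u, sq_nonneg (u - π * x)]

/-- hat-kernel integral of an exponential -/
lemma hat_exp (y : ℂ) (hy : y ≠ 0) (s : ℝ) (hs : s ∈ II) :
    ∫ t in II, (1 - |s - t| : ℝ) * Complex.exp (2 * y * t * I) =
      Complex.exp (2 * y * s * I) / (2 * y ^ 2) - Complex.cos y / (2 * y ^ 2)
        + Complex.sin y / (2 * y) - I * s * Complex.cos y / y := by
  rw [setII]
  have hs' : -(1/2) ≤ s ∧ s ≤ 1/2 := hs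
  have hI : I ≠ 0 := I_ne_zero
  have hcont : Continuous fun t : ℝ => ((1 - |s - t| : ℝ) : ℂ) * Complex.exp (2 * y * t * I) := by
    fun_prop
  rw [← intervalIntegral.integral_add_adjacent_intervals (b := s)
    (hcont.intervalIntegrable _ _) (hcont.intervalIntegrable _ _)]
  have hexp : ∀ t : ℝ, HasDerivAt (fun t : ℝ => Complex.exp (2 * y * t * I))
      (Complex.exp (2 * y * t * I) * (2 * y * I)) t := by
    intro t
    have h1 : HasDerivAt (fun t : ℝ => 2 * y * (t:ℂ) * I) (2 * y * I) t := by
      have := ((Complex.ofRealCLM.hasDerivAt (x := t)).const_mul (2 * y)).mul_const I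
      simpa using this
    exact h1.cexp
  have i1 : ∫ t in (-(1/2):ℝ)..s, ((1 - |s - t| : ℝ) : ℂ) * Complex.exp (2 * y * t * I) =
      ((1 / (2 * y * I) - 1 / (2 * y * I) ^ 2) * Complex.exp (2 * y * s * I))
      - (((1 - s + (-(1/2):ℝ) : ℂ)) / (2 * y * I) - 1 / (2 * y * I) ^ 2) *
        Complex.exp (2 * y * (-(1/2):ℝ) * I) := by
    have h1 : ∫ t in (-(1/2):ℝ)..s, ((1 - |s - t| : ℝ) : ℂ) * Complex.exp (2 * y * t * I) =
      ∫ t in (-(1/2):ℝ)..s, (1 - s + t : ℂ) * Complex.exp (2 * y * t * I) := by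
      apply intervalIntegral.integral_congr
      intro t ht
      rw [Set.uIcc_of_le hs'.1] at ht
      simp only
      rw [abs_of_nonneg (by linarith [ht.2])]
      push_cast; ring
    rw [h1, intervalIntegral.integral_eq_sub_of_hasDerivAt
      (f := fun t : ℝ => ((1 - s + t : ℂ) / (2 * y * I) - 1 / (2 * y * I) ^ 2) *
        Complex.exp (2 * y * t * I))]
    · ring
    · intro t _
      have h2 : HasDerivAt (fun t : ℝ => ((1 - s + t : ℂ) / (2 * y * I) - 1 / (2 * y * I) ^ 2))
          (1 / (2 * y * I)) t := by
        have := (((Complex.ofRealCLM.hasDerivAt (x := t)).const_add (1 - s : ℂ)).div_const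
          (2 * y * I)).sub_const (1 / (2 * y * I) ^ 2)
        simpa using this
      refine (h2.mul (hexp t)).congr_deriv ?_
      field_simp
      ring
    · exact Continuous.intervalIntegrable (by fun_prop) _ _
  have i2 : ∫ t in s..(1/2), ((1 - |s - t| : ℝ) : ℂ) * Complex.exp (2 * y * t * I) =
      ((1 + s - (1/2:ℝ) : ℂ) / (2 * y * I) + 1 / (2 * y * I) ^ 2) * Complex.exp (2 * y * (1/2:ℝ) * I)
      - (1 / (2 * y * I) + 1 / (2 * y * I) ^ 2) * Complex.exp (2 * y * s * I) := by
    have h1 : ∫ t in s..(1/2), ((1 - |s - t| : ℝ) : ℂ) * Complex.exp (2 * y * t * I) =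
      ∫ t in s..(1/2), (1 + s - t : ℂ) * Complex.exp (2 * y * t * I) := by
      apply intervalIntegral.integral_congr
      intro t ht
      rw [Set.uIcc_of_le hs'.2] at ht
      simp only
      rw [abs_of_nonpos (by linarith [ht.1])]
      push_cast; ring
    rw [h1, intervalIntegral.integral_eq_sub_of_hasDerivAt
      (f := fun t : ℝ => ((1 + s - t : ℂ) / (2 * y * I) + 1 / (2 * y * I) ^ 2) *
        Complex.exp (2 * y * t * I))]
    · ring
    · intro t _
      have h2 : HasDerivAt (fun t : ℝ => ((1 + s - t : ℂ) / (2 * y * I) + 1 / (2 * y * I) ^ 2))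
          (-1 / (2 * y * I)) t := by
        have := (((Complex.ofRealCLM.hasDerivAt (x := t)).const_sub (1 + s : ℂ)).div_const
          (2 * y * I)).add_const (1 / (2 * y * I) ^ 2)
        simpa using this
      refine (h2.mul (hexp t)).congr_deriv ?_
      field_simp
      ring
    · exact Continuous.intervalIntegrable (by fun_prop) _ _
  rw [i1, i2, Complex.sin, Complex.cos]
  have e1 : 2 * y * ((1/2:ℝ):ℂ) * I = y * I := by push_cast; ring
  have e2 : 2 * y * ((-(1/2):ℝ):ℂ) * I = -y * I := by push_cast; ring
  rw [e1, e2]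
  push_cast
  generalize cexp (2 * y * s * I) = a
  generalize cexp (y * I) = b
  generalize cexp (-y * I) = c
  have hI2 := I_sq
  have hI3 : I ^ 3 = -I := by rw [pow_succ, I_sq]; ring
  field_simp
  simp only [hI2, hI3]
  ring_nf


lemma a0_pos : 0 < invSqrt2 := by unfold invSqrt2; positivity
lemma a0_sq : invSqrt2 ^ 2 = 1 / 2 := by
  unfold invSqrt2; rw [inv_pow, Real.sq_sqrt (by norm_num)]; norm_num
lemma sqrt2_eq : Real.sqrt 2 = 2 * invSqrt2 := by
  unfold invSqrt2
  rw [← div_eq_mul_inv, eq_div_iff (by positivity), Real.mul_self_sqrt (by norm_num)]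
lemma cos_a0 : 3 / 4 ≤ Real.cos invSqrt2 := by
  have := Real.one_sub_sq_div_two_le_cos (x := invSqrt2)
  rw [a0_sq] at this; linarith
lemma cos_sub_a0 : 0 < Real.cos invSqrt2 - invSqrt2 * Real.sin invSqrt2 := by
  have h1 := cos_a0
  have h2 := Real.sin_le a0_pos.le
  have h3 := a0_sq
  nlinarith [a0_pos]

/-- leading coefficient -/
noncomputable def alp (b : ℝ) : ℂ := 2 * (π:ℂ) ^ 2 * (b:ℂ) ^ 2 / (2 * (π:ℂ) ^ 2 * (b:ℂ) ^ 2 - 1)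
/-- coefficient -/
noncomputable def cA (b : ℝ) : ℂ := (cCoef b + dCoef b) / 2
/-- coefficient -/
noncomputable def cB (b : ℝ) : ℂ := (cCoef b - dCoef b) / 2

/-- The Fourier density of the reproducing kernel. -/
noncomputable def kap (b : ℝ) (t : ℝ) : ℂ :=
  alp b * Complex.exp (2 * (π * b : ℝ) * t * I) + cA b * Complex.exp (2 * (invSqrt2 : ℝ) * t * I)
   + cB b * Complex.exp (2 * (-invSqrt2 : ℝ) * t * I)

/-- The reproducing kernel as an entire function. -/
noncomputable def Kent (b : ℝ) (z : ℂ) : ℂ :=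
  alp b * csinc ((π * b : ℝ) - π * z) + cA b * csinc ((invSqrt2 : ℝ) - π * z)
   + cB b * csinc ((-invSqrt2 : ℝ) - π * z)

lemma kap_cont (b : ℝ) : Continuous (kap b) := by unfold kap; fun_prop

lemma Kent_diff (b : ℝ) : Differentiable ℂ (Kent b) := by
  have := csinc_differentiable
  unfold Kent
  fun_prop

lemma Kent_dec (b : ℝ) : Dec (fun x : ℝ => Kent b x) :=
  (((dec_csinc (π * b)).const_mul _).add ((dec_csinc (invSqrt2)).const_mul _)).add
    ((dec_csinc (-invSqrt2)).const_mul _)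

lemma Kent_bound (b : ℝ) : ∃ C, 0 ≤ C ∧ ∀ z, ‖Kent b z‖ ≤ C * Real.exp (π * |z.im|) := by
  refine ⟨‖alp b‖ + ‖cA b‖ + ‖cB b‖, by positivity, fun z => ?_⟩
  have h : ∀ u : ℝ, ‖csinc (u - π * z)‖ ≤ Real.exp (π * |z.im|) := by
    intro u
    refine (csinc_bound _).trans (le_of_eq ?_)
    congr 1
    simp [abs_mul, abs_of_pos Real.pi_pos]
  unfold Kent
  refine (norm_add₃_le).trans ?_
  rw [norm_mul, norm_mul, norm_mul, add_mul, add_mul]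
  have h1 := h (π * b)
  have h2 := h invSqrt2
  have h3 := h (-invSqrt2)
  gcongr

lemma Kent_neg (b : ℝ) (z : ℂ) : Kent (-b) (-z) = Kent b z := by
  have h1 : alp (-b) = alp b := by simp [alp]
  have h2 : cA (-b) = cB b := by
    simp only [cA, cB, cCoef, dCoef, ofReal_neg, mul_neg, Complex.cos_neg, Complex.sin_neg, neg_mul,
      even_two, Even.neg_pow, neg_neg, neg_div]
    ring
  have h3 : cB (-b) = cA b := by
    simp only [cA, cB, cCoef, dCoef, ofReal_neg, mul_neg, Complex.cos_neg, Complex.sin_neg, neg_mul,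
      even_two, Even.neg_pow, neg_neg, neg_div]
    ring
  unfold Kent
  rw [h1, h2, h3]
  have e : ∀ u : ℝ, csinc ((-u : ℝ) - π * (-z)) = csinc (u - π * z) := by
    intro u; rw [← csinc_even]; congr 1; push_cast; ring
  have e1 := e (π * b)
  have e2 := e invSqrt2
  have e3 := e (-invSqrt2)
  rw [neg_neg] at e3
  rw [show π * -b = -(π * b) by ring, e1, e2, e3]
  ring

lemma exp_trunc (u x : ℝ) : ∫ t in II, Complex.exp (-(2 * π * x * t) * I) *
    Complex.exp (2 * (u:ℝ) * t * I) = csinc (u - π * x) := by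
  rw [← integral_exp_II]
  congr 1; ext t
  rw [← Complex.exp_add]; congr 1; ring

lemma intII (f : ℝ → ℂ) (hf : Continuous f) : Integrable f (volume.restrict II) :=
  hf.continuousOn.integrableOn_Icc

open FourierTransform in
lemma fourier_kap (b x : ℝ) : 𝓕 (trunc (kap b)) x = Kent b x := by
  rw [fourier_trunc]
  unfold kap Kent
  rw [← exp_trunc, ← exp_trunc, ← exp_trunc, ← integral_const_mul, ← integral_const_mul,
    ← integral_const_mul, ← integral_add, ← integral_add]
  · congr 1; ext t; ring
  · exact intII _ (by fun_prop)
  · exact intII _ (by fun_prop)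
  · exact intII _ (by fun_prop)
  · exact intII _ (by fun_prop)

lemma kap_eq (b : ℝ) (hb : b ≠ 0) (hb' : 2 * π ^ 2 * b ^ 2 ≠ 1) (s : ℝ) (hs : s ∈ II) :
    kap b s - ∫ t in II, (1 - |s - t| : ℝ) * kap b t = Complex.exp (2 * (π * b : ℝ) * s * I) := by
  have hpb : π * b ≠ 0 := mul_ne_zero Real.pi_ne_zero hb
  have ha := a0_pos.ne'
  have e : ∫ t in II, (1 - |s - t| : ℝ) * kap b t =
      alp b * (∫ t in II, (1 - |s - t| : ℝ) * Complex.exp (2 * (π * b : ℝ) * t * I))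
      + cA b * (∫ t in II, (1 - |s - t| : ℝ) * Complex.exp (2 * (invSqrt2 : ℝ) * t * I))
      + cB b * (∫ t in II, (1 - |s - t| : ℝ) * Complex.exp (2 * (-invSqrt2 : ℝ) * t * I)) := by
    rw [← integral_const_mul, ← integral_const_mul,
      ← integral_const_mul, ← integral_add, ← integral_add]
    · congr 1; ext t; unfold kap; ring
    · exact intII _ (by fun_prop)
    · exact intII _ (by fun_prop)
    · exact intII _ (by fun_prop)
    · exact intII _ (by fun_prop)
  rw [e, hat_exp _ (by exact_mod_cast hpb) s hs, hat_exp _ (by exact_mod_cast ha) s hs,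
    hat_exp _ (by exact_mod_cast (neg_ne_zero.mpr ha)) s hs]
  unfold kap
  generalize cexp (2 * (π * b : ℝ) * s * I) = E1
  generalize cexp (2 * (invSqrt2 : ℝ) * s * I) = E2
  generalize cexp (2 * (-invSqrt2 : ℝ) * s * I) = E3
  unfold alp cA cB cCoef dCoef
  have hD : (2 * (π:ℂ) ^ 2 * (b:ℂ) ^ 2 - 1) ≠ 0 := by
    have : 2 * π ^ 2 * b ^ 2 - 1 ≠ 0 := sub_ne_zero.mpr hb'
    exact_mod_cast this
  have hD' : (1 - 2 * (π:ℂ) ^ 2 * (b:ℂ) ^ 2) = -(2 * (π:ℂ) ^ 2 * (b:ℂ) ^ 2 - 1) := by ring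
  have hW : ((Real.cos invSqrt2 : ℂ) - (invSqrt2 : ℂ) * (Real.sin invSqrt2 : ℂ)) ≠ 0 := by
    have := cos_sub_a0.ne'
    exact_mod_cast this
  have hC : (Real.cos invSqrt2 : ℂ) ≠ 0 := by
    have : Real.cos invSqrt2 ≠ 0 := by have := cos_a0; positivity
    exact_mod_cast this
  have ha0 : (invSqrt2 : ℂ) ≠ 0 := by exact_mod_cast ha
  have ha2 : (invSqrt2 : ℂ) ^ 2 = 1 / 2 := by
    have := a0_sq
    rw [← Complex.ofReal_pow, this]; push_cast; rfl
  have hpi : (π:ℂ) ≠ 0 := by exact_mod_cast Real.pi_ne_zero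
  have hbc : (b:ℂ) ≠ 0 := by exact_mod_cast hb
  rw [hD', sqrt2_eq]
  push_cast
  rw [Complex.cos_neg, Complex.sin_neg]
  rw [← Complex.ofReal_cos, ← Complex.ofReal_sin] at *
  generalize (Real.cos invSqrt2 : ℂ) = ca at *
  generalize (Real.sin invSqrt2 : ℂ) = sa at *
  generalize (invSqrt2 : ℂ) = a at *
  generalize Complex.cos (π * b) = cb at *
  generalize Complex.sin (π * b) = sb at *
  have h1 : 2 * (-a) ^ 2 = 1 := by rw [neg_sq, ha2]; norm_num
  have h2 : 2 * a ^ 2 = 1 := by rw [ha2]; norm_num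
  rw [h1, h2]
  have hp : (π * b : ℂ) ≠ 0 := mul_ne_zero hpi hbc
  have hDp : (2 * (π:ℂ) ^ 2 * (b:ℂ) ^ 2 - 1) = 2 * (π * b : ℂ) ^ 2 - 1 := by ring
  have hNp : (2 * (π:ℂ) ^ 2 * (b:ℂ) ^ 2) = 2 * (π * b : ℂ) ^ 2 := by ring
  have hEp : (2 * (π:ℂ) * (b:ℂ) * cb) = 2 * (π * b : ℂ) * cb := by ring
  rw [hEp]
  rw [hDp] at hD ⊢
  rw [hNp]
  generalize (π * b : ℂ) = p at *
  set c := (cb - p * sb) / (-(2 * p ^ 2 - 1) * (ca - a * sa)) with hcdef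
  set d := 2 * p * cb / (-(2 * p ^ 2 - 1) * (2 * a) * ca) with hddef
  have hc : c * (ca - a * sa) = - ((cb - p * sb) / (2 * p ^ 2 - 1)) := by
    rw [hcdef]; field_simp
  have hd : d * ca / a = - (2 * p * cb / (2 * p ^ 2 - 1)) := by
    rw [hddef]; field_simp; linear_combination (2 * cb) * ha2
  have hsa : sa / (2 * a) = a * sa := by field_simp; linear_combination (-2 * sa) * ha2
  have hsa' : -sa / (2 * -a) = a * sa := by rw [← hsa]; field_simp
  rw [hsa, hsa']
  have k1 : 2 * p ^ 2 / (2 * p ^ 2 - 1) * (E1 - (E1 / (2 * p ^ 2) - cb / (2 * p ^ 2) + sb / (2 * p)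
      - I * s * cb / p)) = E1 + (cb - p * sb) / (2 * p ^ 2 - 1)
        + I * s * (2 * p * cb / (2 * p ^ 2 - 1)) := by
    field_simp
    ring
  linear_combination k1 + hc + I * s * hd

open FourierTransform ComplexConjugate in
lemma repro (b : ℝ) (hb : b ≠ 0) (hb' : 2 * π ^ 2 * b ^ 2 ≠ 1) (p : ℝ → ℂ) (hp : Continuous p)
    (hd : Dec (𝓕 (trunc p))) :
    ∫ x, 𝓕 (trunc p) x * conj (Kent b x) * (pairCorKernel x : ℂ) = 𝓕 (trunc p) b := by
  have h := rk1 p (kap b) hp (kap_cont b) (by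
    simp only [fourier_kap]; exact hd.integrable (Kent_dec b))
  simp only [fourier_kap] at h
  rw [h, fourier_trunc]
  apply setIntegral_congr_fun (show MeasurableSet II from measurableSet_Icc)
  intro s hs
  simp only
  rw [kap_eq b hb hb' s hs]
  have h2 : conj (2:ℂ) = 2 := Complex.conj_ofNat 2
  simp only [map_mul, RCLike.conj_conj, ← Complex.exp_conj, Complex.conj_ofReal, h2, conj_I]
  rw [mul_comm]
  congr 2
  push_cast; ring

lemma Kker_eq (b z : ℝ) (hz : 2 * π ^ 2 * z ^ 2 ≠ 1) : Kker b z = Kent b z := by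
  have hD : (1 - 2 * (π:ℂ) ^ 2 * (z:ℂ) ^ 2) ≠ 0 := by
    have : 1 - 2 * π ^ 2 * z ^ 2 ≠ 0 := sub_ne_zero.mpr (Ne.symm hz)
    exact_mod_cast this
  have ha2 : (invSqrt2 : ℂ) ^ 2 = 1 / 2 := by
    have := a0_sq
    rw [← Complex.ofReal_pow, this]; push_cast; rfl
  have hz1 : ∀ z' : ℝ, z' = (π * Real.sqrt 2)⁻¹ → 2 * π ^ 2 * z' ^ 2 = 1 := by
    rintro _ rfl
    rw [inv_pow, mul_pow, Real.sq_sqrt (by norm_num)]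
    have := Real.pi_ne_zero
    field_simp
  have hn1 : (z:ℂ) ≠ ((π * Real.sqrt 2)⁻¹ : ℝ) := by
    intro h
    exact hz (hz1 z (by exact_mod_cast h))
  have hn2 : (z:ℂ) ≠ -((π * Real.sqrt 2)⁻¹ : ℝ) := by
    intro h
    have h' : z = -((π * Real.sqrt 2)⁻¹ : ℝ) := by exact_mod_cast h
    have := hz1 (-z) (by rw [h', neg_neg])
    rw [neg_sq] at this
    exact hz this
  have hp : ∀ a : ℂ, a ^ 2 = 1 / 2 → a - π * z ≠ 0 := by
    intro a ha h
    apply hD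
    have : a = π * z := sub_eq_zero.mp h
    rw [this] at ha
    linear_combination (-2) * ha
  have hm := hp invSqrt2 ha2
  have hm' := hp (-invSqrt2) (by rw [neg_sq, ha2])
  unfold Kker Kent cA cB
  rw [Complex.conj_ofReal]
  unfold fFun gFun hFun
  rw [if_neg hD, if_neg hn1, if_neg hn2, show csinc (π * (z - b)) = csinc ((π * b : ℝ) - π * z) by
    rw [← csinc_even]; congr 1; push_cast; ring]
  have hf : csinc ((invSqrt2:ℝ) - π * z) = Complex.sin (invSqrt2 - π * z) / (invSqrt2 - π * z) := by
    rw [csinc, if_neg hm]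
  have hf' : csinc ((-invSqrt2:ℝ) - π * z) =
      Complex.sin (-invSqrt2 - π * z) / (-invSqrt2 - π * z) := by
    have : (((-invSqrt2:ℝ):ℂ) - π * z) = (-invSqrt2 - π * z) := by push_cast; ring
    rw [this, csinc, if_neg hm']
  rw [hf, hf', Complex.sin_sub, Complex.sin_sub, Complex.sin_neg, Complex.cos_neg, sqrt2_eq]
  have hal : 2 * (π:ℂ) ^ 2 * (b:ℂ) ^ 2 / (2 * (π:ℂ) ^ 2 * (b:ℂ) ^ 2 - 1) = alp b := rfl
  rw [hal]
  push_cast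
  generalize Complex.cos (invSqrt2 : ℂ) = ca at *
  generalize Complex.sin (invSqrt2 : ℂ) = sa at *
  generalize (invSqrt2 : ℂ) = a at *
  generalize cCoef b = c
  generalize dCoef b = d
  generalize csinc _ = e
  have hD2 : (1 - 2 * (π:ℂ) ^ 2 * (z:ℂ) ^ 2) = 2 * (a - π * z) * (-(-a - π * z)) := by
    linear_combination (-2) * ha2
  rw [hD2]
  have h2a : (-a - π * z) ≠ 0 := hm'
  field_simp
  ring


open FourierTransform in
/-- Paley-Wiener functions with decay. -/
def PW (F : ℝ → ℂ) : Prop := Dec F ∧ ∃ p, Continuous p ∧ F = 𝓕 (trunc p)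

lemma pw_Kent (b : ℝ) : PW (fun x : ℝ => Kent b x) :=
  ⟨Kent_dec b, kap b, kap_cont b, by ext x; rw [fourier_kap]⟩

lemma PW.const_mul {F : ℝ → ℂ} (h : PW F) (c : ℂ) : PW (fun x => c * F x) := by
  obtain ⟨h1, p, hp, rfl⟩ := h
  refine ⟨h1.const_mul c, fun t => c * p t, by fun_prop, ?_⟩
  ext x
  rw [fourier_trunc, fourier_trunc, ← integral_const_mul]
  congr 1; ext t; ring

lemma PW.add {F G : ℝ → ℂ} (h : PW F) (h' : PW G) : PW (fun x => F x + G x) := by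
  obtain ⟨h1, p, hp, rfl⟩ := h
  obtain ⟨h1', q, hq, rfl⟩ := h'
  refine ⟨h1.add h1', fun t => p t + q t, by fun_prop, ?_⟩
  ext x
  rw [fourier_trunc, fourier_trunc, fourier_trunc, ← integral_add]
  · congr 1; ext t; ring
  · exact intII _ (by fun_prop)
  · exact intII _ (by fun_prop)

open ComplexConjugate in
lemma PW.repro {F : ℝ → ℂ} (h : PW F) (b : ℝ) (hb : b ≠ 0) (hb' : 2 * π ^ 2 * b ^ 2 ≠ 1) :
    ∫ x, F x * conj (Kent b x) * (pairCorKernel x : ℂ) = F b := by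
  obtain ⟨h1, p, hp, rfl⟩ := h
  exact _root_.repro b hb hb' p hp h1

open ComplexConjugate in
lemma PW.repro2 {F : ℝ → ℂ} (h : PW F) (b : ℝ) (hb : b ≠ 0) (hb' : 2 * π ^ 2 * b ^ 2 ≠ 1) (u v : ℂ) :
    ∫ x, F x * conj (u * Kent b x + v * Kent (-b) x) * (pairCorKernel x : ℂ)
      = conj u * F b + conj v * F (-b) := by
  rw [← h.repro b hb hb', ← h.repro (-b) (by simpa using hb) (by simpa using hb'),
    ← integral_const_mul, ← integral_const_mul, ← integral_add]
  · congr 1; ext x; simp only [map_add, map_mul]; ring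
  · exact (h.1.integrable_w (Kent_dec b)).const_mul _
  · exact (h.1.integrable_w (Kent_dec (-b))).const_mul _

lemma Dec.integrable_sq {F : ℝ → ℂ} (h : Dec F) :
    Integrable (fun x => ‖F x‖ ^ 2 * pairCorKernel x) := by
  have := (h.integrable_w h).re
  refine this.congr (Eventually.of_forall fun x => ?_)
  simp only [Complex.mul_conj]
  rw [← Complex.ofReal_mul, Complex.normSq_eq_norm_sq]
  exact Complex.ofReal_re _

open ComplexConjugate in
lemma Dec.norm_int {F : ℝ → ℂ} :
    ((∫ x, ‖F x‖ ^ 2 * pairCorKernel x : ℝ) : ℂ) = ∫ x, F x * conj (F x) * (pairCorKernel x : ℂ) := by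
  rw [← integral_complex_ofReal]
  congr 1; ext x
  rw [Complex.mul_conj, Complex.normSq_eq_norm_sq]; push_cast; rfl

open ComplexConjugate in
lemma Dec.quad {F G : ℝ → ℂ} (h : Dec F) (h' : Dec G) (t : ℝ) :
    0 ≤ (∫ x, ‖F x‖ ^ 2 * pairCorKernel x)
      - 2 * t * (∫ x, F x * conj (G x) * (pairCorKernel x : ℂ)).re
      + t ^ 2 * ∫ x, ‖G x‖ ^ 2 * pairCorKernel x := by
  have e1 : (∫ x, F x * conj (G x) * (pairCorKernel x : ℂ)).re =
      ∫ x, (F x * conj (G x)).re * pairCorKernel x := by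
    have := integral_re (h.integrable_w h')
    simp only [RCLike.re_eq_complex_re] at this
    rw [← this]
    congr 1; ext x; simp
  have i1 : Integrable (fun x => (F x * conj (G x)).re * pairCorKernel x) := by
    refine (h.integrable_w h').re.congr (Eventually.of_forall fun x => ?_)
    simp
  have i2 : Integrable (fun x => ‖F x‖ ^ 2 * pairCorKernel x
      - 2 * t * ((F x * conj (G x)).re * pairCorKernel x)) := h.integrable_sq.sub (i1.const_mul _)
  rw [e1, ← integral_const_mul, ← integral_const_mul, ← integral_sub h.integrable_sq (i1.const_mul _),
    ← integral_add i2 (h'.integrable_sq.const_mul _)]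
  apply integral_nonneg
  intro x
  have : ‖F x - t * G x‖ ^ 2 = ‖F x‖ ^ 2 - 2 * t * (F x * conj (G x)).re + t ^ 2 * ‖G x‖ ^ 2 := by
    simp only [← Complex.normSq_eq_norm_sq, Complex.normSq_apply]
    simp; ring
  have h3 : 0 ≤ ‖F x - t * G x‖ ^ 2 * pairCorKernel x := mul_nonneg (sq_nonneg _) (w_nonneg x)
  rw [this] at h3
  simp only [Pi.zero_apply]
  linarith

/-- The constant kappa. -/
noncomputable def kpp (b : ℝ) : ℝ := (Kent b b).re + ‖Kent b (-b : ℝ)‖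

open ComplexConjugate in
lemma normG_le (b : ℝ) (hb : b ≠ 0) (hb' : 2 * π ^ 2 * b ^ 2 ≠ 1) (u v : ℂ) :
    ∫ x : ℝ, ‖u * Kent b x + v * Kent (-b) x‖ ^ 2 * pairCorKernel x
      ≤ kpp b * (‖u‖ ^ 2 + ‖v‖ ^ 2) := by
  have hG : PW (fun x : ℝ => u * Kent b x + v * Kent (-b) x) :=
    ((pw_Kent b).const_mul u).add ((pw_Kent (-b)).const_mul v)
  have h1 := hG.repro2 b hb hb' u v
  rw [← Dec.norm_int (F := fun x : ℝ => u * Kent b x + v * Kent (-b) x)] at h1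
  have e1 : Kent (-b) ((-b : ℝ) : ℂ) = Kent b b := by rw [ofReal_neg, Kent_neg]
  have e2 : Kent (-b) (b : ℂ) = Kent b (-b : ℝ) := by
    rw [← Kent_neg b, ofReal_neg, neg_neg]
  rw [e1, e2] at h1
  have h2 := congrArg Complex.re h1
  rw [Complex.ofReal_re] at h2
  rw [h2]
  set k := Kent b b
  set l := Kent b (-b : ℝ)
  have e3 : (conj u * (u * k + v * l) + conj v * (u * l + v * k)) =
     ((‖u‖ ^ 2 + ‖v‖ ^ 2 : ℝ) : ℂ) * k + (conj u * v * l + conj v * u * l) := by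
    have hu : conj u * u = ((‖u‖ ^ 2 : ℝ) : ℂ) := by
      rw [mul_comm, Complex.mul_conj, Complex.normSq_eq_norm_sq]
    have hv : conj v * v = ((‖v‖ ^ 2 : ℝ) : ℂ) := by
      rw [mul_comm, Complex.mul_conj, Complex.normSq_eq_norm_sq]
    rw [Complex.ofReal_add]
    linear_combination k * hu + k * hv
  rw [e3, Complex.add_re, Complex.re_ofReal_mul]
  have h4 : (conj u * v * l + conj v * u * l).re ≤ 2 * ‖u‖ * ‖v‖ * ‖l‖ := by
    refine (Complex.re_le_norm _).trans ((norm_add_le _ _).trans (le_of_eq ?_))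
    simp only [norm_mul, RCLike.norm_conj]; ring
  have h5 : 2 * ‖u‖ * ‖v‖ * ‖l‖ ≤ (‖u‖ ^ 2 + ‖v‖ ^ 2) * ‖l‖ := by
    have := sq_nonneg (‖u‖ - ‖v‖)
    have := norm_nonneg l
    nlinarith
  unfold kpp
  have : (Kent b (b:ℂ)) = k := rfl
  linarith

open ComplexConjugate in
lemma bl_pre (b : ℝ) (hb : b ≠ 0) (hb' : 2 * π ^ 2 * b ^ 2 ≠ 1) {F : ℝ → ℂ} (hF : PW F) (t : ℝ) :
    2 * t * (‖F b‖ ^ 2 + ‖F (-b)‖ ^ 2) ≤ (∫ x, ‖F x‖ ^ 2 * pairCorKernel x)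
      + t ^ 2 * (kpp b * (‖F b‖ ^ 2 + ‖F (-b)‖ ^ 2)) := by
  have hG : PW (fun x : ℝ => F b * Kent b x + F (-b) * Kent (-b) x) :=
    ((pw_Kent b).const_mul (F b)).add ((pw_Kent (-b)).const_mul (F (-b)))
  have h1 := hF.1.quad hG.1 t
  rw [hF.repro2 b hb hb'] at h1
  have h2 := normG_le b hb hb' (F b) (F (-b))
  have e : (conj (F b) * F b + conj (F (-b)) * F (-b)).re = ‖F b‖ ^ 2 + ‖F (-b)‖ ^ 2 := by
    rw [mul_comm, Complex.mul_conj, mul_comm (conj _), Complex.mul_conj,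
      Complex.normSq_eq_norm_sq, Complex.normSq_eq_norm_sq, ← Complex.ofReal_add, Complex.ofReal_re]
  rw [e] at h1
  have := mul_le_mul_of_nonneg_left h2 (sq_nonneg t)
  linarith

lemma pw_exp (b : ℝ) : PW (fun x : ℝ => csinc ((π * b : ℝ) - π * x)) := by
  refine ⟨dec_csinc (π * b), fun t => Complex.exp (2 * (π * b : ℝ) * t * I), by fun_prop, ?_⟩
  ext x
  rw [fourier_trunc, exp_trunc]

lemma kpp_pos (b : ℝ) (hb : b ≠ 0) (hb' : 2 * π ^ 2 * b ^ 2 ≠ 1) : 0 < kpp b := by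
  by_contra hk
  push Not at hk
  set F : ℝ → ℂ := fun x : ℝ => csinc ((π * b : ℝ) - π * x) with hFd
  have hFb : F b = 1 := by simp [hFd, csinc]
  set J := ∫ x, ‖F x‖ ^ 2 * pairCorKernel x with hJ
  have hJ0 : 0 ≤ J := integral_nonneg fun x => mul_nonneg (sq_nonneg _) (w_nonneg x)
  have h := bl_pre b hb hb' (pw_exp b) (J + 1)
  change 2 * (J + 1) * (‖F b‖ ^ 2 + ‖F (-b)‖ ^ 2) ≤ J
      + (J + 1) ^ 2 * (kpp b * (‖F b‖ ^ 2 + ‖F (-b)‖ ^ 2)) at h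
  set S := ‖F b‖ ^ 2 + ‖F (-b)‖ ^ 2 with hS
  have hS1 : 1 ≤ S := by rw [hS, hFb]; simp
  have h2 : (J + 1) ^ 2 * (kpp b * S) ≤ 0 :=
    mul_nonpos_of_nonneg_of_nonpos (sq_nonneg _) (mul_nonpos_of_nonpos_of_nonneg hk (by linarith))
  nlinarith

lemma bl (b : ℝ) (hb : b ≠ 0) (hb' : 2 * π ^ 2 * b ^ 2 ≠ 1) {F : ℝ → ℂ} (hF : PW F) :
    ‖F b‖ ^ 2 + ‖F (-b)‖ ^ 2 ≤ kpp b * ∫ x, ‖F x‖ ^ 2 * pairCorKernel x := by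
  have hk := kpp_pos b hb hb'
  have h := bl_pre b hb hb' hF (1 / kpp b)
  have h2 := mul_le_mul_of_nonneg_left h hk.le
  set S := ‖F b‖ ^ 2 + ‖F (-b)‖ ^ 2
  set J := ∫ x, ‖F x‖ ^ 2 * pairCorKernel x
  have e1 : kpp b * (2 * (1 / kpp b) * S) = 2 * S := by field_simp
  have e2 : kpp b * (J + (1 / kpp b) ^ 2 * (kpp b * S)) = kpp b * J + S := by field_simp
  rw [e1, e2] at h2
  linarith


/-- multiplier -/
noncomputable def phi (η x : ℝ) : ℝ := Real.sinc (π * η * x) ^ 2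

lemma phi_cont (η : ℝ) : Continuous (phi η) := by
  have := Real.continuous_sinc
  unfold phi; fun_prop

lemma phi_nonneg (η x : ℝ) : 0 ≤ phi η x := sq_nonneg _

lemma phi_le_one (η x : ℝ) : phi η x ≤ 1 := by
  unfold phi
  rw [← sq_abs]
  exact pow_le_one₀ (abs_nonneg _) (Real.abs_sinc_le_one _)

lemma phi_neg (η x : ℝ) : phi η (-x) = phi η x := by
  unfold phi; rw [mul_neg, Real.sinc_neg]

lemma phi_decay (η : ℝ) (hη : 0 < η) : ∃ C, 0 ≤ C ∧ ∀ x, phi η x ≤ C / (1 + x ^ 2) := by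
  have hc : 0 < π * η := by positivity
  refine ⟨2 * (1 + 1 / (π * η) ^ 2), by positivity, fun x => ?_⟩
  refine (sinc_sq_bound (π * η * x)).trans ?_
  rw [div_le_div_iff₀ (by positivity) (by positivity)]
  have e : (1 + 1 / (π * η) ^ 2) * (1 + (π * η * x) ^ 2) =
      1 + x ^ 2 + (π * η * x) ^ 2 + 1 / (π * η) ^ 2 := by
    field_simp; ring
  have h1 : 0 ≤ (π * η * x) ^ 2 := by positivity
  have h2 : 0 ≤ 1 / (π * η) ^ 2 := by positivity
  nlinarith

lemma phi_integrable (η : ℝ) (hη : 0 < η) : Integrable (phi η) := by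
  obtain ⟨C, hC, h⟩ := phi_decay η hη
  refine Integrable.mono' ((integrable_inv_one_add_sq).const_mul C)
    (phi_cont η).aestronglyMeasurable (Eventually.of_forall fun x => ?_)
  rw [Real.norm_eq_abs, abs_of_nonneg (phi_nonneg _ _)]
  simpa [div_eq_mul_inv] using h x

open FourierTransform in
lemma pw_exp_phi (η : ℝ) (hη : 0 < η) (ξ : ℝ) (hξ : |ξ| + η ≤ 1 / 2) :
    PW (fun x : ℝ => Complex.exp (2 * π * I * ξ * x) * (phi η x : ℂ)) := by
  have hn : ∀ x : ℝ, ‖Complex.exp (2 * π * I * ξ * x)‖ = 1 := by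
    intro x
    have : (2 * π * I * ξ * x : ℂ) = ((2 * π * ξ * x : ℝ) : ℂ) * I := by push_cast; ring
    rw [this, Complex.norm_exp_ofReal_mul_I]
  refine ⟨⟨?_, ?_⟩, fun t => ((η⁻¹ * hat ((t + ξ) / η) : ℝ) : ℂ), ?_, ?_⟩
  · have := phi_cont η
    fun_prop
  · obtain ⟨C, hC, h⟩ := phi_decay η hη
    refine ⟨C, fun x => ?_⟩
    rw [norm_mul, hn, one_mul, Complex.norm_real, Real.norm_eq_abs, abs_of_nonneg (phi_nonneg _ _)]
    refine le_trans ?_ (h x)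
    nlinarith [phi_nonneg η x, phi_le_one η x]
  · have := hat_cont
    fun_prop
  · ext x
    have ht : trunc (fun t => ((η⁻¹ * hat ((t + ξ) / η) : ℝ) : ℂ)) =
        fun t => ((η⁻¹ * hat ((t + ξ) / η) : ℝ) : ℂ) := by
      ext t
      unfold trunc
      by_cases h : t ∈ II
      · rw [Set.indicator_of_mem h]
      · rw [Set.indicator_of_notMem h]
        have h1 : 1/2 < |t| := by
          by_contra hh
          push Not at hh
          exact h (abs_le.mp hh)
        have h2 : η ≤ |t + ξ| := by
          have := abs_sub_abs_le_abs_sub t (-ξ)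
          rw [abs_neg, sub_neg_eq_add] at this
          linarith
        have h3 : hat ((t + ξ) / η) = 0 := by
          unfold hat
          apply max_eq_right
          rw [abs_div, abs_of_pos hη]
          have : 1 ≤ |t + ξ| / η := by rwa [le_div_iff₀ hη, one_mul]
          linarith
        rw [h3]; simp
    rw [ht, Real.fourier_eq']
    have e1 : ∀ t : ℝ, cexp (((-2 * π * inner ℝ t x : ℝ) : ℂ) * I) •
        ((η⁻¹ * hat ((t + ξ) / η) : ℝ) : ℂ) =
        (fun s : ℝ => (fun u : ℝ => (η:ℂ)⁻¹ * Complex.exp (2 * π * I * ξ * x) *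
          (cexp (((-2 * π * inner ℝ u (η * x) : ℝ) : ℂ) * I) • (hat u : ℂ))) (s / η)) (t + ξ) := by
      intro t
      have hη' : (η:ℂ) ≠ 0 := by exact_mod_cast hη.ne'
      simp only [smul_eq_mul]
      have : cexp (((-2 * π * inner ℝ t x : ℝ) : ℂ) * I) = Complex.exp (2 * π * I * ξ * x) *
        cexp (((-2 * π * inner ℝ ((t + ξ)/η) (η * x) : ℝ) : ℂ) * I) := by
        rw [← Complex.exp_add]; congr 1
        simp
        field_simp
        ring
      rw [this]; push_cast; ring
    simp_rw [e1]
    rw [integral_add_right_eq_self (μ := volume) (fun s : ℝ => (fun u : ℝ => (η:ℂ)⁻¹ * Complex.exp (2 * π * I * ξ * x) *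
          (cexp (((-2 * π * inner ℝ u (η * x) : ℝ) : ℂ) * I) • (hat u : ℂ))) (s / η)) ξ,
      Measure.integral_comp_div (fun u : ℝ => (η:ℂ)⁻¹ * Complex.exp (2 * π * I * ξ * x) *
          (cexp (((-2 * π * inner ℝ u (η * x) : ℝ) : ℂ) * I) • (hat u : ℂ))) η,
      integral_const_mul, ← Real.fourier_eq', fourier_hat, abs_of_pos hη]
    have h4 := csinc_real (π * (η * x))
    have h5 : π * (η * x) = π * η * x := by ring
    rw [h5] at h4
    have hη' : (η:ℂ) ≠ 0 := by exact_mod_cast hη.ne'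
    have h6 : csinc (π * ((η * x : ℝ) : ℂ)) = ((Real.sinc (π * η * x) : ℝ) : ℂ) := by
      rw [← h4]; congr 1; push_cast; ring
    rw [h6, phi, real_smul]
    push_cast
    field_simp

lemma pw_zero : PW (fun _ => 0) := by
  simpa using (pw_Kent 0).const_mul 0

lemma pw_sum {ι : Type*} (s : Finset ι) (F : ι → ℝ → ℂ) (h : ∀ i ∈ s, PW (F i)) :
    PW (fun x => ∑ i ∈ s, F i x) := by
  classical
  induction s using Finset.induction_on with
  | empty => simpa using pw_zero
  | insert i s hi ih =>
    simp_rw [Finset.sum_insert hi]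
    exact (h i (by simp)).add (ih fun j hj => h j (by simp [hj]))

open Polynomial in
lemma pw_poly (η : ℝ) (hη : 0 < η) (N m : ℕ) (hN : 1 ≤ N) (hm : (m:ℝ) / (2 * N) + η ≤ 1/2)
    (p : ℂ[X]) (hp : p.natDegree ≤ m) :
    PW (fun x : ℝ => p.eval (Complex.exp (2 * π * I * (x / N : ℝ))) *
      Complex.exp (2 * π * I * (-(m / (2 * N)) : ℝ) * x) * (phi η x : ℂ)) := by
  have hN0 : (0:ℝ) < N := by exact_mod_cast hN
  have h := pw_sum (Finset.range (m + 1))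
    (fun n x => p.coeff n * (Complex.exp (2 * π * I * (n / N - m / (2 * N) : ℝ) * x) * (phi η x : ℂ))) (by
      intro n hn
      apply PW.const_mul
      apply pw_exp_phi η hη
      have hn' : (n:ℝ) ≤ m := by
        rw [Finset.mem_range] at hn
        exact_mod_cast Nat.lt_succ_iff.mp hn
      have h1 : |(n / N - m / (2 * N) : ℝ)| ≤ m / (2 * N) := by
        have e : (n / N - m / (2 * N) : ℝ) = (2 * n - m) / (2 * N) := by field_simp
        rw [e, abs_div, abs_of_pos (show (0:ℝ) < 2 * N by positivity)]
        gcongr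
        rw [abs_le]
        have : (0:ℝ) ≤ n := by positivity
        constructor <;> linarith
      linarith)
  convert h using 2 with x
  rw [Polynomial.eval_eq_sum_range' (n := m + 1) (by omega), Finset.sum_mul, Finset.sum_mul]
  apply Finset.sum_congr rfl
  intro n _
  rw [← Complex.exp_nat_mul]
  have : cexp (2 * π * I * (n / N - m / (2 * N) : ℝ) * x) =
    cexp (n * (2 * π * I * (x / N : ℝ))) * cexp (2 * π * I * (-(m / (2 * N)) : ℝ) * x) := by
    rw [← Complex.exp_add]; congr 1; push_cast; ring
  rw [this]; ring


lemma shift_decay (x y : ℝ) : 1 / (1 + (x + y) ^ 2) ≤ 2 * (1 + x ^ 2) / (1 + y ^ 2) := by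
  rw [div_le_div_iff₀ (by positivity) (by positivity)]
  nlinarith [sq_nonneg (x + y + x), sq_nonneg (x * (x + y)), sq_nonneg x, sq_nonneg (x + y)]

lemma lower_eta (b : ℝ) (hb : b ≠ 0) (hb' : 2 * π ^ 2 * b ^ 2 ≠ 1)
    (H : ℂ → ℂ) (hH : Differentiable ℂ H) (σ C : ℝ) (hσ : 0 ≤ σ)
    (hbd : ∀ z : ℂ, ‖H z‖ ≤ C * Real.exp (2 * π * σ * |z.im|) / (1 + z.re ^ 2))
    (h : ℝ → ℝ) (hh : ∀ x : ℝ, H x = (h x : ℂ)) (hpos : ∀ x, 0 ≤ h x)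
    (η : ℝ) (hη : 0 < η) (hση : σ / 2 + η ≤ 1 / 2) :
    phi η b ^ 2 * (h b + h (-b)) ≤ kpp b * ∫ x, h x * pairCorKernel x := by
  have hk := kpp_pos b hb hb'
  have hhb : ∀ x : ℝ, h x ≤ C / (1 + x ^ 2) := by
    intro x
    have := hbd x
    rw [hh, Complex.norm_real, Real.norm_eq_abs, abs_of_nonneg (hpos x)] at this
    simpa using this
  have hC : 0 ≤ C := by simpa using (hpos 0).trans (hhb 0)
  have hhc : Continuous h := by
    have h1 : Continuous fun x : ℝ => (H x).re :=
      Complex.continuous_re.comp (hH.continuous.comp Complex.continuous_ofReal)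
    simpa [hh] using h1
  have hhi : Integrable h := by
    refine Integrable.mono' ((integrable_inv_one_add_sq).const_mul C)
      hhc.aestronglyMeasurable (Eventually.of_forall fun x => ?_)
    rw [Real.norm_eq_abs, abs_of_nonneg (hpos _)]
    simpa [div_eq_mul_inv] using hhb x
  have hhw : Integrable (fun x => h x * pairCorKernel x) := by
    refine hhi.mul_bdd (c := 1) w_meas.aestronglyMeasurable (Eventually.of_forall fun x => ?_)
    rw [Real.norm_eq_abs, abs_of_nonneg (w_nonneg x)]
    exact w_le_one x
  obtain ⟨C1, hC1, hphi⟩ := phi_decay η hη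
  set Z : ℝ := ∑' k : ℤ, 1 / (k:ℝ) ^ 2 with hZ
  have hZs : Summable (fun k : ℤ => 1 / (k:ℝ) ^ 2) := Real.summable_one_div_int_pow.mpr (by norm_num)
  have hZ0 : 0 ≤ Z := tsum_nonneg fun k => by positivity
  set Φ := ∫ x, phi η x with hΦ
  have hΦ0 : 0 ≤ Φ := integral_nonneg fun x => phi_nonneg η x
  set J := ∫ x, h x * pairCorKernel x with hJ
  -- key inequality
  have key : ∀ N : ℕ, 1 ≤ N → phi η b ^ 2 * (h b + h (-b)) ≤
      kpp b * (J + (2 * C * Z * C1 + 1) * Φ / N) := by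
    intro N hN
    have hN0 : (0:ℝ) < N := by exact_mod_cast hN
    have hN1 : (1:ℝ) ≤ N := by exact_mod_cast hN
    set m := ⌊σ * N⌋₊ with hm
    have hm1 : 2 * π * σ * N < 2 * π * (m + 1) := by
      have := Nat.lt_floor_add_one (σ * N)
      have := Real.pi_pos
      rw [mul_assoc]
      gcongr
    have hm2 : (m:ℝ) ≤ σ * N := Nat.floor_le (by positivity)
    have hm3 : (m:ℝ) / (2 * N) + η ≤ 1 / 2 := by
      have : (m:ℝ) / (2 * N) ≤ σ / 2 := by
        rw [div_le_div_iff₀ (by positivity) (by norm_num)]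
        linarith
      linarith
    have hε : (0:ℝ) < 1 / N := by positivity
    obtain ⟨p, hp, hpe⟩ := exists_factor H hH (2 * π * σ) C (by positivity) hbd h hh hpos N hN m hm1
      (1 / N) hε
    have hpw := pw_poly η hη N m hN hm3 p hp
    have hbl := bl b hb hb' hpw
    have hnorm : ∀ x : ℝ, ‖p.eval (Complex.exp (2 * π * I * (x / N : ℝ))) *
      Complex.exp (2 * π * I * (-(m / (2 * N)) : ℝ) * x) * (phi η x : ℂ)‖ ^ 2 =
        ((∑' k : ℤ, h (x + k * N)) + 1 / N) * phi η x ^ 2 := by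
      intro x
      have : (2 * π * I * (-(m / (2 * N)) : ℝ) * x : ℂ) =
        ((2 * π * (-(m / (2 * N))) * x : ℝ) : ℂ) * I := by push_cast; ring
      rw [hpe, this, norm_mul, norm_mul, Complex.norm_exp_ofReal_mul_I, mul_one, mul_pow,
        Complex.norm_real, Real.norm_eq_abs, sq_abs]
    have hterm : ∀ (x : ℝ) (k : ℤ), h (x + k * N) ≤ (if k = 0 then h x else 0) +
        (2 * C * (1 + x ^ 2) / N ^ 2) * (1 / (k:ℝ) ^ 2) := by
      intro x k
      split_ifs with hk0
      · subst hk0; simp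
      · have hk1 : (0:ℝ) < (k:ℝ) ^ 2 := by positivity
        rw [zero_add]
        calc h (x + k * N) ≤ C / (1 + (x + k * N) ^ 2) := hhb _
          _ = C * (1 / (1 + (x + k * N) ^ 2)) := by ring
          _ ≤ C * (2 * (1 + x ^ 2) / (1 + (k * N) ^ 2)) :=
              mul_le_mul_of_nonneg_left (shift_decay x (k * N)) hC
          _ ≤ C * (2 * (1 + x ^ 2) / (k * N) ^ 2) := by
              have : (0:ℝ) < (k * N) ^ 2 := by rw [mul_pow]; positivity
              gcongr
              linarith
          _ = _ := by rw [mul_pow]; field_simp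
    have hs1 : ∀ x : ℝ, Summable (fun k : ℤ => (if k = 0 then h x else 0) +
        (2 * C * (1 + x ^ 2) / N ^ 2) * (1 / (k:ℝ) ^ 2)) := fun x =>
      (hasSum_ite_eq (0:ℤ) (h x)).summable.add (hZs.mul_left _)
    have hs2 : ∀ x : ℝ, Summable (fun k : ℤ => h (x + k * N)) := fun x =>
      Summable.of_nonneg_of_le (fun k => hpos _) (hterm x) (hs1 x)
    have hup : ∀ x : ℝ, (∑' k : ℤ, h (x + k * N)) ≤ h x + (2 * C * (1 + x ^ 2) / N ^ 2) * Z := by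
      intro x
      refine ((hs2 x).tsum_le_tsum (hterm x) (hs1 x)).trans (le_of_eq ?_)
      rw [((hasSum_ite_eq (0:ℤ) (h x)).summable).tsum_add (hZs.mul_left _), tsum_ite_eq, tsum_mul_left]
    have hlo : ∀ x : ℝ, h x ≤ ∑' k : ℤ, h (x + k * N) := by
      intro x
      have := (hs2 x).le_tsum (0:ℤ) (fun k _ => hpos _)
      simpa using this
    simp only [hnorm] at hbl
    have l1 : phi η b ^ 2 * (h b + h (-b)) ≤ ((∑' k : ℤ, h (b + k * N)) + 1 / N) * phi η b ^ 2 +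
        ((∑' k : ℤ, h (-b + k * N)) + 1 / N) * phi η (-b) ^ 2 := by
      rw [phi_neg]
      have h1 := hlo b
      have h2 := hlo (-b)
      have h3 := sq_nonneg (phi η b)
      nlinarith
    refine l1.trans (hbl.trans ?_)
    apply mul_le_mul_of_nonneg_left _ hk.le
    have e : J + (2 * C * Z * C1 + 1) * Φ / N =
        ∫ x, (h x * pairCorKernel x + (2 * C * Z * C1 + 1) / N * phi η x) := by
      rw [integral_add hhw ((phi_integrable η hη).const_mul _), integral_const_mul]
      ring
    rw [e]
    refine integral_mono_of_nonneg (Eventually.of_forall fun x => ?_)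
      (hhw.add ((phi_integrable η hη).const_mul _)) (Eventually.of_forall fun x => ?_)
    · have : 0 ≤ ∑' k : ℤ, h (x + k * N) := tsum_nonneg fun k => hpos _
      have := w_nonneg x
      simp only [Pi.zero_apply]
      positivity
    · simp only
      have w0 := w_nonneg x
      have w1 := w_le_one x
      have p0 := phi_nonneg η x
      have p1 := phi_le_one η x
      have hx := hpos x
      have hp2 : phi η x ^ 2 ≤ phi η x := by nlinarith
      have hp3 : phi η x ^ 2 ≤ 1 := by nlinarith
      have hdx : (1 + x ^ 2) * phi η x ≤ C1 := by
        have := hphi x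
        rw [le_div_iff₀ (by positivity)] at this
        linarith
      have hNN : 1 / (N:ℝ) ^ 2 ≤ 1 / N := by
        apply one_div_le_one_div_of_le hN0
        nlinarith
      calc ((∑' k : ℤ, h (x + k * N)) + 1 / N) * phi η x ^ 2 * pairCorKernel x
          ≤ ((h x + (2 * C * (1 + x ^ 2) / N ^ 2) * Z) + 1 / N) * phi η x ^ 2 * pairCorKernel x := by
            gcongr; exact hup x
        _ = h x * pairCorKernel x * phi η x ^ 2 + ((2 * C * Z) * (1 / N ^ 2) * ((1 + x ^ 2) * phi η x)
            * phi η x + 1 / N * phi η x ^ 2) * pairCorKernel x := by ring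
        _ ≤ h x * pairCorKernel x * 1 + ((2 * C * Z) * (1 / N) * C1
            * phi η x + 1 / N * phi η x) * 1 := by
            gcongr
        _ = _ := by ring
  have hlim : Tendsto (fun N : ℕ => kpp b * (J + (2 * C * Z * C1 + 1) * Φ / N)) atTop
      (nhds (kpp b * (J + 0))) := by
    apply Tendsto.const_mul
    apply Tendsto.const_add
    exact tendsto_const_div_atTop_nhds_zero_nat _
  rw [add_zero] at hlim
  refine ge_of_tendsto hlim ?_
  filter_upwards [eventually_ge_atTop 1] with N hN using key N hN

lemma lower_C (b : ℝ) (hb : b ≠ 0) (hb' : 2 * π ^ 2 * b ^ 2 ≠ 1)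
    (H : ℂ → ℂ) (hH : Differentiable ℂ H) (σ C : ℝ) (hσ : 0 ≤ σ) (hσ1 : σ < 1)
    (hbd : ∀ z : ℂ, ‖H z‖ ≤ C * Real.exp (2 * π * σ * |z.im|) / (1 + z.re ^ 2))
    (h : ℝ → ℝ) (hh : ∀ x : ℝ, H x = (h x : ℂ)) (hpos : ∀ x, 0 ≤ h x) :
    h b + h (-b) ≤ kpp b * ∫ x, h x * pairCorKernel x := by
  have hlim : Tendsto (fun η : ℝ => phi η b ^ 2 * (h b + h (-b))) (nhdsWithin 0 (Set.Ioi 0))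
      (nhds (phi 0 b ^ 2 * (h b + h (-b)))) := by
    apply Tendsto.mono_left _ nhdsWithin_le_nhds
    apply Continuous.tendsto (f := fun η : ℝ => phi η b ^ 2 * (h b + h (-b)))
    have := Real.continuous_sinc
    unfold phi
    fun_prop
  have e : phi 0 b = 1 := by simp [phi]
  rw [e, one_pow, one_mul] at hlim
  refine le_of_tendsto hlim ?_
  have : Set.Ioo (0:ℝ) ((1 - σ) / 2) ∈ nhdsWithin (0:ℝ) (Set.Ioi 0) :=
    Ioo_mem_nhdsGT (by linarith)
  filter_upwards [this] with η hη
  exact lower_eta b hb hb' H hH σ C hσ hbd h hh hpos η hη.1 (by linarith [hη.2])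


lemma lower_delta (b : ℝ) (hb : b ≠ 0) (hb' : 2 * π ^ 2 * b ^ 2 ≠ 1) (R : ℝ → ℝ) (hR : Integrable R)
    (F : ℂ → ℂ) (hF : Differentiable ℂ F) (hexp : HasExpTypeLE F (2 * π))
    (hFR : ∀ x : ℝ, F x = (R x : ℂ)) (hpos : ∀ x, 0 ≤ R x) (δ : ℝ) (h0 : 0 < δ) (h1 : δ < 1 / 2) :
    R ((1 - 2 * δ) * b) * Real.sinc (π * δ * b) ^ 2 +
      R ((1 - 2 * δ) * (-b)) * Real.sinc (π * δ * (-b)) ^ 2 ≤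
      kpp b * ((1 - 2 * δ)⁻¹ * ∫ y, R y * (1 - Real.sinc (π * (y / (1 - 2 * δ))) ^ 2)) := by
  have hπ := Real.pi_pos
  have hc : 0 < 1 - 2 * δ := by linarith
  obtain ⟨C, hC, hCb⟩ := bound_of_expType R hR F hF (2 * π) (by positivity) hexp hFR (π * δ)
    (by positivity)
  have key := lower_C b hb hb' (fun z => F ((1 - 2 * δ : ℝ) * z) * csinc ((π * δ : ℝ) * z) ^ 2)
    (by
      have := csinc_differentiable
      fun_prop) (1 - δ / 2 - δ ^ 2) (C * (2 * (1 + 1 / (π * δ) ^ 2)))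
    (by nlinarith) (by nlinarith) (by
      intro z
      have a1 := hCb ((1 - 2 * δ : ℝ) * z)
      have a2 := csinc_sq_bound ((π * δ : ℝ) * z)
      rw [Complex.im_ofReal_mul, abs_mul, abs_of_pos hc] at a1
      rw [Complex.im_ofReal_mul, Complex.re_ofReal_mul, abs_mul,
        abs_of_pos (show 0 < π * δ by positivity)] at a2
      rw [norm_mul, norm_pow]
      refine (mul_le_mul a1 a2 (by positivity) (by positivity)).trans ?_
      have e : Real.exp (2 * π * (1 - δ / 2 - δ ^ 2) * |z.im|) =
        Real.exp ((2 * π + π * δ) * ((1 - 2 * δ) * |z.im|)) * Real.exp (2 * (π * δ * |z.im|)) := by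
        rw [← Real.exp_add]; congr 1; ring
      rw [e]
      have a3 : 1 / (1 + (π * δ * z.re) ^ 2) ≤ (1 + 1 / (π * δ) ^ 2) / (1 + z.re ^ 2) := by
        rw [div_le_div_iff₀ (by positivity) (by positivity)]
        have : (1 + 1 / (π * δ) ^ 2) * (1 + (π * δ * z.re) ^ 2) =
          1 + z.re ^ 2 + 1 / (π * δ) ^ 2 + (π * δ * z.re) ^ 2 := by
          field_simp; ring
        rw [this]
        have : 0 ≤ 1 / (π * δ) ^ 2 := by positivity
        have := sq_nonneg (π * δ * z.re)
        linarith
      set E1 := Real.exp ((2 * π + π * δ) * ((1 - 2 * δ) * |z.im|))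
      set E2 := Real.exp (2 * (π * δ * |z.im|))
      have hE1 : 0 < E1 := Real.exp_pos _
      have hE2 : 0 < E2 := Real.exp_pos _
      calc C * E1 * (2 * E2 / (1 + (π * δ * z.re) ^ 2))
          = (C * E1 * 2 * E2) * (1 / (1 + (π * δ * z.re) ^ 2)) := by ring
        _ ≤ (C * E1 * 2 * E2) * ((1 + 1 / (π * δ) ^ 2) / (1 + z.re ^ 2)) :=
            mul_le_mul_of_nonneg_left a3 (by positivity)
        _ = _ := by ring)
    (fun x => R ((1 - 2 * δ) * x) * Real.sinc (π * δ * x) ^ 2)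
    (by
      intro x
      rw [← Complex.ofReal_mul, ← Complex.ofReal_mul, hFR, csinc_real]
      push_cast; rfl)
    (fun x => mul_nonneg (hpos _) (sq_nonneg _))
  refine key.trans (mul_le_mul_of_nonneg_left ?_ (kpp_pos b hb hb').le)
  have hW : ∀ y, 0 ≤ 1 - Real.sinc y ^ 2 ∧ 1 - Real.sinc y ^ 2 ≤ 1 := by
    intro y
    have h1 := Real.abs_sinc_le_one y
    have h2 : Real.sinc y ^ 2 ≤ 1 := (sq_le_one_iff_abs_le_one _).2 h1
    constructor
    · linarith
    · nlinarith [sq_nonneg (Real.sinc y)]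
  have hintg : Integrable (fun y => R y * (1 - Real.sinc (π * (y / (1 - 2 * δ))) ^ 2)) := by
    refine hR.mono (hR.1.mul ?_) (Eventually.of_forall fun y => ?_)
    · have := Real.continuous_sinc
      exact Continuous.aestronglyMeasurable (by fun_prop)
    · rw [norm_mul, Real.norm_eq_abs (1 - _), abs_of_nonneg (hW _).1]
      exact mul_le_of_le_one_right (norm_nonneg _) (hW _).2
  have e1 := MeasureTheory.Measure.integral_comp_mul_left
    (fun y => R y * (1 - Real.sinc (π * (y / (1 - 2 * δ))) ^ 2)) (1 - 2 * δ)
  rw [abs_of_pos (inv_pos.2 hc), smul_eq_mul] at e1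
  rw [← e1]
  refine integral_mono_of_nonneg (Eventually.of_forall fun x => ?_) (hintg.comp_mul_left' hc.ne') ?_
  · exact mul_nonneg (mul_nonneg (hpos _) (sq_nonneg _)) (w_nonneg x)
  · filter_upwards [w_ae] with x hx
    rw [hx, mul_div_cancel_left₀ _ hc.ne']
    refine mul_le_mul_of_nonneg_right ?_ (hW _).1
    refine mul_le_of_le_one_right (hpos _) ?_
    have := (hW (π * δ * x)).1
    linarith

lemma lower_R (b : ℝ) (hb : b ≠ 0) (hb' : 2 * π ^ 2 * b ^ 2 ≠ 1) (R : ℝ → ℝ) (hR : Integrable R)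
    (F : ℂ → ℂ) (hF : Differentiable ℂ F) (hexp : HasExpTypeLE F (2 * π))
    (hFR : ∀ x : ℝ, F x = (R x : ℂ)) (hpos : ∀ x, 0 ≤ R x) :
    R b + R (-b) ≤ kpp b * Mpc R := by
  have hRc : Continuous R := by
    have : R = fun x : ℝ => (F x).re := by ext x; rw [hFR, Complex.ofReal_re]
    rw [this]
    exact Complex.continuous_re.comp (hF.continuous.comp Complex.continuous_ofReal)
  have hsc := Real.continuous_sinc
  have hM : Mpc R = ∫ y, R y * (1 - Real.sinc (π * y) ^ 2) := by
    unfold Mpc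
    refine integral_congr_ae ?_
    filter_upwards [w_ae] with x hx
    rw [hx]
  have t1 : Tendsto (fun δ : ℝ => R ((1 - 2 * δ) * b) * Real.sinc (π * δ * b) ^ 2 +
      R ((1 - 2 * δ) * (-b)) * Real.sinc (π * δ * (-b)) ^ 2) (nhdsWithin 0 (Set.Ioi 0))
      (nhds (R b + R (-b))) := by
    have : Continuous (fun δ : ℝ => R ((1 - 2 * δ) * b) * Real.sinc (π * δ * b) ^ 2 +
      R ((1 - 2 * δ) * (-b)) * Real.sinc (π * δ * (-b)) ^ 2) := by fun_prop
    have h := (this.tendsto 0).mono_left (nhdsWithin_le_nhds (s := Set.Ioi 0))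
    simpa using h
  have tc : Tendsto (fun δ : ℝ => (1 - 2 * δ)⁻¹) (nhdsWithin 0 (Set.Ioi 0)) (nhds 1) := by
    have h : ContinuousAt (fun δ : ℝ => (1 - 2 * δ)⁻¹) 0 := by
      apply ContinuousAt.inv₀ (by fun_prop); norm_num
    have := h.tendsto.mono_left (nhdsWithin_le_nhds (s := Set.Ioi 0))
    simpa using this
  have t2 : Tendsto (fun δ : ℝ => ∫ y, R y * (1 - Real.sinc (π * (y / (1 - 2 * δ))) ^ 2))
      (nhdsWithin 0 (Set.Ioi 0)) (nhds (∫ y, R y * (1 - Real.sinc (π * y) ^ 2))) := by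
    refine tendsto_integral_filter_of_dominated_convergence (fun y => ‖R y‖)
      (Eventually.of_forall fun δ => ?_) (Eventually.of_forall fun δ =>
        Eventually.of_forall fun y => ?_) hR.norm (Eventually.of_forall fun y => ?_)
    · exact Continuous.aestronglyMeasurable (by fun_prop)
    · have h1 := Real.abs_sinc_le_one (π * (y / (1 - 2 * δ)))
      have h2 := (sq_le_one_iff_abs_le_one _).2 h1
      have h3 := sq_nonneg (Real.sinc (π * (y / (1 - 2 * δ))))
      rw [norm_mul]
      refine mul_le_of_le_one_right (norm_nonneg _) ?_
      rw [Real.norm_eq_abs, abs_le]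
      constructor <;> linarith
    · have : Tendsto (fun δ : ℝ => y * (1 - 2 * δ)⁻¹) (nhdsWithin 0 (Set.Ioi 0)) (nhds (y * 1)) :=
        tc.const_mul y
      rw [mul_one] at this
      have hc : Continuous (fun u : ℝ => R y * (1 - Real.sinc (π * u) ^ 2)) := by fun_prop
      exact (hc.tendsto y).comp this
  have t3 := (tc.mul t2).const_mul (kpp b)
  rw [one_mul, ← hM] at t3
  refine le_of_tendsto_of_tendsto t1 t3 ?_
  have : Set.Ioo (0:ℝ) (1 / 2) ∈ nhdsWithin 0 (Set.Ioi (0:ℝ)) := Ioo_mem_nhdsGT (by norm_num)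
  filter_upwards [this] with δ hδ
  exact lower_delta b hb hb' R hR F hF hexp hFR hpos δ hδ.1 hδ.2


lemma Kent_neg_swap (b : ℝ) : Kent (-b) (b : ℂ) = Kent b (-b : ℝ) := by
  rw [← Kent_neg b, ofReal_neg, neg_neg]

open ComplexConjugate in
lemma Kent_diag_real (b : ℝ) (hb : b ≠ 0) (hb' : 2 * π ^ 2 * b ^ 2 ≠ 1) :
    Kent b b = ((Kent b b).re : ℂ) := by
  have h := (pw_Kent b).repro b hb hb'
  rw [← Dec.norm_int (F := fun x : ℝ => Kent b x)] at h
  rw [← h, Complex.ofReal_re]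

open ComplexConjugate in
lemma Kent_off_real (b : ℝ) (hb : b ≠ 0) (hb' : 2 * π ^ 2 * b ^ 2 ≠ 1) :
    Kent b (-b : ℝ) = ((Kent b (-b : ℝ)).re : ℂ) := by
  have h1 := (pw_Kent b).repro (-b) (by simpa using hb) (by simpa using hb')
  have h2 := (pw_Kent (-b)).repro b hb hb'
  rw [Kent_neg_swap] at h2
  have h3 : conj (Kent b (-b : ℝ)) = Kent b (-b : ℝ) := by
    conv_lhs => rw [← h2]
    rw [← h1, ← integral_conj]
    congr 1; ext x
    simp only [map_mul, Complex.conj_conj, Complex.conj_ofReal]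
    ring
  exact (Complex.conj_eq_iff_re.1 h3).symm

open ComplexConjugate in
lemma attained (b : ℝ) (hb : b ≠ 0) (hb' : 2 * π ^ 2 * b ^ 2 ≠ 1) :
    ∃ R ∈ OmegaClass b, Mpc R = 2 / kpp b := by
  have hk := kpp_pos b hb hb'
  have hπ := Real.pi_pos
  obtain ⟨s, hs, hsl⟩ : ∃ s : ℝ, s ^ 2 = 1 ∧ s * (Kent b (-b : ℝ)).re = |(Kent b (-b : ℝ)).re| := by
    rcases le_total 0 (Kent b (-b : ℝ)).re with h | h
    · exact ⟨1, by norm_num, by rw [abs_of_nonneg h, one_mul]⟩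
    · exact ⟨-1, by norm_num, by rw [abs_of_nonpos h]; ring⟩
  have hkp : kpp b = (Kent b b).re + s * (Kent b (-b : ℝ)).re := by
    unfold kpp
    rw [hsl]
    conv_lhs => rw [Kent_off_real b hb hb', Complex.norm_real, Real.norm_eq_abs]
  set k : ℂ → ℂ := fun z => 1 * Kent b z + (s : ℂ) * Kent (-b) z with hkdef
  have hpw : PW (fun x : ℝ => k x) := ((pw_Kent b).const_mul 1).add ((pw_Kent (-b)).const_mul s)
  have e1 : k b = (kpp b : ℂ) := by
    simp only [hkdef]
    rw [Kent_neg_swap, Kent_diag_real b hb hb', Kent_off_real b hb hb', hkp]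
    push_cast; ring
  have e2 : k (-b : ℝ) = (s * kpp b : ℂ) := by
    simp only [hkdef]
    have : Kent (-b) ((-b : ℝ) : ℂ) = Kent b b := by rw [ofReal_neg, Kent_neg]
    rw [this, Kent_diag_real b hb hb', Kent_off_real b hb hb', hkp]
    have : (s : ℂ) ^ 2 = 1 := by exact_mod_cast hs
    simp only [Complex.ofReal_add, Complex.ofReal_mul]
    linear_combination (-((Kent b (-b : ℝ)).re : ℂ)) * this
  have hintg := hpw.repro2 b hb hb' 1 s
  rw [← Dec.norm_int (F := fun x : ℝ => k x)] at hintg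
  have hint2 : ∫ x : ℝ, ‖k x‖ ^ 2 * pairCorKernel x = 2 * kpp b := by
    have h2 : (s : ℂ) ^ 2 = 1 := by exact_mod_cast hs
    rw [e1, e2, map_one, Complex.conj_ofReal] at hintg
    have : ((∫ x : ℝ, ‖k x‖ ^ 2 * pairCorKernel x : ℝ) : ℂ) = ((2 * kpp b : ℝ) : ℂ) := by
      rw [hintg]; push_cast; linear_combination (kpp b : ℂ) * h2
    exact_mod_cast this
  have kd : Differentiable ℂ k := by
    have h1 := Kent_diff b
    have h2 := Kent_diff (-b)
    fun_prop
  obtain ⟨C, hC0, hC⟩ : ∃ C, 0 ≤ C ∧ ∀ z, ‖k z‖ ≤ C * Real.exp (π * |z.im|) := by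
    obtain ⟨C1, h1, hC1⟩ := Kent_bound b
    obtain ⟨C2, h2, hC2⟩ := Kent_bound (-b)
    refine ⟨C1 + |s| * C2, by positivity, fun z => ?_⟩
    refine (norm_add_le _ _).trans ?_
    rw [norm_mul, norm_mul, norm_one, one_mul, Complex.norm_real, Real.norm_eq_abs]
    have := mul_le_mul_of_nonneg_left (hC2 z) (abs_nonneg s)
    linarith [hC1 z]
  refine ⟨fun x => ‖k x‖ ^ 2 / kpp b ^ 2, ⟨⟨?_, ?_⟩, ?_, ?_, ?_⟩, ?_⟩
  · have h := (hpw.1.integrable hpw.1).norm.div_const (kpp b ^ 2)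
    refine h.congr (Eventually.of_forall fun x => ?_)
    simp [sq]
  · refine ⟨fun z => k z * conj (k (conj z)) / (kpp b : ℂ) ^ 2, ?_, ?_, ?_⟩
    · have : Differentiable ℂ (fun z => conj (k (conj z))) := by
        intro z
        have h := (kd (conj z)).conj_conj
        rw [Complex.conj_conj] at h
        exact h
      exact (kd.mul this).div_const _
    · intro ε hε
      refine ⟨C * C / kpp b ^ 2 + 1, by positivity, fun z => ?_⟩
      rw [norm_div, norm_mul, RCLike.norm_conj, norm_pow, Complex.norm_real, Real.norm_eq_abs, sq_abs]
      have h1 := hC z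
      have h2 := hC (conj z)
      rw [Complex.conj_im, abs_neg] at h2
      have h3 : Real.exp (π * |z.im|) * Real.exp (π * |z.im|) ≤ Real.exp ((2 * π + ε) * ‖z‖) := by
        rw [← Real.exp_add, Real.exp_le_exp]
        have := Complex.abs_im_le_norm z
        have := norm_nonneg z
        nlinarith
      have h4 : ‖k z‖ * ‖k (conj z)‖ ≤ C * C * Real.exp ((2 * π + ε) * ‖z‖) := by
        refine (mul_le_mul h1 h2 (norm_nonneg _) (by positivity)).trans ?_
        have := mul_le_mul_of_nonneg_left h3 (mul_nonneg hC0 hC0)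
        linarith
      have h5 : ‖k z‖ * ‖k (conj z)‖ / kpp b ^ 2 ≤
          C * C * Real.exp ((2 * π + ε) * ‖z‖) / kpp b ^ 2 := by gcongr
      refine h5.trans ?_
      rw [add_mul (C * C / kpp b ^ 2), one_mul]
      have := Real.exp_pos ((2 * π + ε) * ‖z‖)
      have e : C * C * Real.exp ((2 * π + ε) * ‖z‖) / kpp b ^ 2 =
        C * C / kpp b ^ 2 * Real.exp ((2 * π + ε) * ‖z‖) := by ring
      linarith
    · intro x
      simp only
      rw [Complex.conj_ofReal, Complex.mul_conj, Complex.normSq_eq_norm_sq]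
      push_cast; rfl
  · intro x; positivity
  · simp only
    rw [e1, Complex.norm_real, Real.norm_eq_abs, sq_abs, div_self (by positivity)]
  · simp only
    rw [e2, norm_mul, mul_pow, Complex.norm_real, Complex.norm_real, Real.norm_eq_abs, sq_abs,
      Real.norm_eq_abs, sq_abs, hs, one_mul, div_self (by positivity)]
  · unfold Mpc
    have : (fun x : ℝ => ‖k x‖ ^ 2 / kpp b ^ 2 * pairCorKernel x) =
        fun x : ℝ => (‖k x‖ ^ 2 * pairCorKernel x) / kpp b ^ 2 := by ext x; ring
    rw [this, integral_div, hint2]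
    field_simp

theorem two_delta_problem (β : ℝ) (hβ : 0 < β) (hβ' : 2 * π ^ 2 * β ^ 2 ≠ 1) :
    IsLeast (Mpc '' OmegaClass β)
      (2 / ((Kker (β : ℂ) (β : ℂ)).re + ‖Kker (β : ℂ) (-β : ℂ)‖)) := by
  have e : (Kker (β : ℂ) (β : ℂ)).re + ‖Kker (β : ℂ) (-β : ℂ)‖ = kpp β := by
    unfold kpp
    rw [← Complex.ofReal_neg, Kker_eq β β hβ', Kker_eq β (-β) (by simpa using hβ')]
  rw [e]
  constructor
  · obtain ⟨R, h1, h2⟩ := attained β hβ.ne' hβ'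
    exact ⟨R, h1, h2⟩
  · rintro _ ⟨R, ⟨⟨hR, F, hF, hexp, hFR⟩, hpos, h1, h2⟩, rfl⟩
    have := lower_R β hβ.ne' hβ' R hR F hF hexp hFR hpos
    rw [div_le_iff₀ (kpp_pos β hβ.ne' hβ')]
    linarith
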